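/- For a permutation w in S_n with length ℓ(w) = ℓ, the Bruhat interval polytope Q_{e,w} is combinatorially equivalent to the product Perm_2 × I^{ℓ−3} of the hexagon Perm_2 = conv{(σ(1),σ(2),σ(3)) ∈ ℝ^3 : σ ∈ S_3} and the cube I^{ℓ−3} = [0,1]^{ℓ−3} if and only if w contains the pattern 321 exactly once and avoids the pattern 3412. -/

import Mathlib

/-- `simpleT n i` is the adjacent transposition `sᵢ = (i, i+1)` (one-indexed values),
acting on `{1, …, n}` represented (zero-indexed) by `Fin n`.  It is the identity
permutation when `i` is outside the valid range `1 ≤ i ≤ n - 1`. -/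
def simpleT (n : ℕ) (i : ℕ) : Equiv.Perm (Fin n) :=
  if h : 1 ≤ i ∧ i < n then Equiv.swap ⟨i - 1, by omega⟩ ⟨i, h.2⟩ else 1

/-- The (Coxeter) length `ℓ(w)`: the minimal number of adjacent transpositions whose
product is `w`. -/
noncomputable def permLen (n : ℕ) (w : Equiv.Perm (Fin n)) : ℕ :=
  sInf {l : ℕ | ∃ word : List ℕ, word.length = l ∧ (word.map (simpleT n)).prod = w}

/-- `word` is a reduced decomposition of `w`: its product is `w` and its length is `ℓ(w)`. -/
def IsReducedWord (n : ℕ) (word : List ℕ) (w : Equiv.Perm (Fin n)) : Prop :=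
  (word.map (simpleT n)).prod = w ∧ word.length = permLen n w

/-- The support of `w`: the set of letters `i` such that `sᵢ` appears in some reduced
decomposition of `w`. -/
def permSupp (n : ℕ) (w : Equiv.Perm (Fin n)) : Set ℕ :=
  {i | ∃ word : List ℕ, IsReducedWord n word w ∧ i ∈ word}

/-- Bruhat order: `v ≤ w` iff some reduced decomposition of `v` is a subword of some
reduced decomposition of `w`. -/
def bruhatLE (n : ℕ) (v w : Equiv.Perm (Fin n)) : Prop :=
  ∃ wordv wordw : List ℕ, IsReducedWord n wordv v ∧ IsReducedWord n wordw w ∧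
    wordv.Sublist wordw

/-- Strict Bruhat order. -/
def bruhatLT (n : ℕ) (v w : Equiv.Perm (Fin n)) : Prop :=
  bruhatLE n v w ∧ v ≠ w

/-- An occurrence of the pattern `p ∈ S_k` in `w ∈ S_n`: a strictly increasing sequence
`j` of indices such that the entries of `w` along `j` are in the same relative order
as the entries of `p`. -/
def IsPatternOcc {n k : ℕ} (w : Equiv.Perm (Fin n)) (p : Equiv.Perm (Fin k))
    (j : Fin k → Fin n) : Prop :=
  StrictMono j ∧ ∀ a b : Fin k, w (j a) < w (j b) ↔ p a < p b

/-- `w` contains the pattern `p`. -/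
def ContainsPattern {n k : ℕ} (w : Equiv.Perm (Fin n)) (p : Equiv.Perm (Fin k)) : Prop :=
  ∃ j : Fin k → Fin n, IsPatternOcc w p j

/-- `w` avoids the pattern `p`. -/
def AvoidsPattern {n k : ℕ} (w : Equiv.Perm (Fin n)) (p : Equiv.Perm (Fin k)) : Prop :=
  ¬ ContainsPattern w p

/-- `w` contains the pattern `p` exactly once. -/
def ContainsPatternOnce {n k : ℕ} (w : Equiv.Perm (Fin n)) (p : Equiv.Perm (Fin k)) : Prop :=
  ∃! j : Fin k → Fin n, IsPatternOcc w p j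

/-- The number of occurrences of the pattern `p` in `w`. -/
noncomputable def numOcc {n k : ℕ} (w : Equiv.Perm (Fin n)) (p : Equiv.Perm (Fin k)) : ℕ :=
  Set.ncard {j : Fin k → Fin n | IsPatternOcc w p j}

/-- The pattern `321` (one-line notation `1↦3, 2↦2, 3↦1`), as a permutation of `Fin 3`. -/
def pattern321 : Equiv.Perm (Fin 3) := Equiv.swap 0 2

/-- The pattern `3412` (one-line notation `1↦3, 2↦4, 3↦1, 4↦2`). -/
def pattern3412 : Equiv.Perm (Fin 4) := Equiv.swap 0 2 * Equiv.swap 1 3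

/-- The pattern `4231` (one-line notation `1↦4, 2↦2, 3↦3, 4↦1`). -/
def pattern4231 : Equiv.Perm (Fin 4) := Equiv.swap 0 3

/-- The pattern `4321` (one-line notation `1↦4, 2↦3, 3↦2, 4↦1`). -/
def pattern4321 : Equiv.Perm (Fin 4) := Equiv.swap 0 3 * Equiv.swap 1 2

/-- The point `(u(1), …, u(n)) ∈ ℝⁿ` attached to a permutation `u` (one-indexed values). -/
def permPoint (n : ℕ) (u : Equiv.Perm (Fin n)) : Fin n → ℝ :=
  fun k => ((u k : ℕ) : ℝ) + 1

/-- The Bruhat interval polytope `Q_{v,w}`: the convex hull of the points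
`(u(1), …, u(n))` for all `u` with `v ≤ u ≤ w` in Bruhat order. -/
noncomputable def BIP (n : ℕ) (v w : Equiv.Perm (Fin n)) : Set (Fin n → ℝ) :=
  convexHull ℝ
    {x | ∃ u : Equiv.Perm (Fin n), bruhatLE n v u ∧ bruhatLE n u w ∧ x = permPoint n u}

/-- A face of a polytope `P`: a convex extreme subset of `P`. -/
def IsFaceOf {E : Type*} [AddCommGroup E] [Module ℝ E] (P F : Set E) : Prop :=
  IsExtreme ℝ P F ∧ Convex ℝ F

/-- Combinatorial equivalence of two polytopes: an inclusion-preserving (in both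
directions) bijection between their face lattices. -/
def CombEquiv {E F : Type*} [AddCommGroup E] [Module ℝ E] [AddCommGroup F] [Module ℝ F]
    (P : Set E) (Q : Set F) : Prop :=
  ∃ e : {A : Set E // IsFaceOf P A} ≃ {B : Set F // IsFaceOf Q B},
    ∀ A B : {A : Set E // IsFaceOf P A}, A.1 ⊆ B.1 ↔ (e A).1 ⊆ (e B).1

/-- The transposition `(i, j)` (one-indexed values, `1 ≤ i < j ≤ n`), acting on
`{1, …, n}` represented by `Fin n`; identity for invalid input. -/
def transpPerm (n i j : ℕ) : Equiv.Perm (Fin n) :=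
  if h : 1 ≤ i ∧ i < j ∧ j ≤ n then Equiv.swap ⟨i - 1, by omega⟩ ⟨j - 1, by omega⟩ else 1

/-- `T̄(u,[v,w])`: the set of transpositions `(i,j)`, `i < j`, with
`u < u·(i,j) ≤ w` and `ℓ(u·(i,j)) = ℓ(u) + 1`. -/
def upperT (n : ℕ) (u v w : Equiv.Perm (Fin n)) : Set (ℕ × ℕ) :=
  {p | 1 ≤ p.1 ∧ p.1 < p.2 ∧ p.2 ≤ n ∧
    bruhatLT n u (u * transpPerm n p.1 p.2) ∧ bruhatLE n (u * transpPerm n p.1 p.2) w ∧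
    permLen n (u * transpPerm n p.1 p.2) = permLen n u + 1}

/-- `T̲(u,[v,w])`: the set of transpositions `(i,j)`, `i < j`, with
`v ≤ u·(i,j) < u` and `ℓ(u·(i,j)) = ℓ(u) - 1`. -/
def lowerT (n : ℕ) (u v w : Equiv.Perm (Fin n)) : Set (ℕ × ℕ) :=
  {p | 1 ≤ p.1 ∧ p.1 < p.2 ∧ p.2 ≤ n ∧
    bruhatLE n v (u * transpPerm n p.1 p.2) ∧ bruhatLT n (u * transpPerm n p.1 p.2) u ∧
    permLen n (u * transpPerm n p.1 p.2) + 1 = permLen n u}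

/-- The permutohedron `Perm₂ ⊂ ℝ³`, a hexagon. -/
noncomputable def Perm2Hex : Set (Fin 3 → ℝ) :=
  convexHull ℝ {x | ∃ σ : Equiv.Perm (Fin 3), x = permPoint 3 σ}

/-- The action of `s_r` on one-indexed letters: swaps `r` and `r + 1`. -/
def srNat (r x : ℕ) : ℕ := if x = r then r + 1 else if x = r + 1 then r else x



section CombPart
open Equiv Finset

variable {n : ℕ}

/-- rank function -/
def rk (w : Perm (Fin n)) (i q : ℕ) : ℕ :=
  (Finset.univ.filter fun p : Fin n => p.val < i ∧ (w p).val < q).card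

/-- dominance order -/
def BD (u w : Perm (Fin n)) : Prop := ∀ i q, rk w i q ≤ rk u i q

/-- number of inversions -/
def invN (w : Perm (Fin n)) : ℕ :=
  (Finset.univ.filter fun p : Fin n × Fin n => p.1 < p.2 ∧ w p.2 < w p.1).card

lemma simpleT_eq {A B : Fin n} (h : (B : ℕ) = A + 1) : simpleT n B = swap A B := by
  unfold simpleT
  rw [dif_pos ⟨by omega, B.2⟩]
  congr 1
  ext; simp; omega

lemma simpleT_cases (n i : ℕ) : simpleT n i = 1 ∨
    ∃ A B : Fin n, (B : ℕ) = A + 1 ∧ i = B ∧ simpleT n i = swap A B := by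
  unfold simpleT
  split_ifs with h
  · right
    exact ⟨⟨i-1, by omega⟩, ⟨i, h.2⟩, by simp; omega, rfl, rfl⟩
  · left; rfl

lemma swap_lt_iff {A B : Fin n} (h : (B : ℕ) = A + 1) (p : Fin n) (i : ℕ) (hi : i ≠ B) :
    ((swap A B p : Fin n) : ℕ) < i ↔ (p : ℕ) < i := by
  rcases eq_or_ne p A with rfl | hA
  · rw [swap_apply_left]; omega
  rcases eq_or_ne p B with rfl | hB
  · rw [swap_apply_right]; omega
  rw [swap_apply_of_ne_of_ne hA hB]

lemma rk_mul_swap_ne (w : Perm (Fin n)) {A B : Fin n} (h : (B : ℕ) = A + 1) (i q : ℕ)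
    (hi : i ≠ B) : rk (w * swap A B) i q = rk w i q := by
  unfold rk
  refine Finset.card_bij (fun p _ => swap A B p) ?_ ?_ ?_
  · intro p hp
    rw [mem_filter] at hp ⊢
    exact ⟨mem_univ _, (swap_lt_iff h p i hi).2 hp.2.1, hp.2.2⟩
  · intro p _ q _ hpq
    exact (swap A B).injective hpq
  · intro p hp
    rw [mem_filter] at hp
    refine ⟨swap A B p, ?_, by simp⟩
    rw [mem_filter]
    exact ⟨mem_univ _, (swap_lt_iff h p i hi).2 hp.2.1, by simpa using hp.2.2⟩

lemma rk_succ (w : Perm (Fin n)) (A : Fin n) (q : ℕ) :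
    rk w (A + 1) q = rk w A q + if (w A : ℕ) < q then 1 else 0 := by
  unfold rk
  have : (univ.filter fun p : Fin n => p.val < (A : ℕ) + 1 ∧ (w p).val < q) =
      (univ.filter fun p : Fin n => p.val < (A : ℕ) ∧ (w p).val < q) ∪
       (univ.filter fun p : Fin n => p = A ∧ (w p).val < q) := by
    ext p
    simp only [mem_filter, mem_univ, true_and, mem_union]
    rw [Fin.ext_iff]
    grind
  rw [this, card_union_of_disjoint]
  · congr 1
    split_ifs with hq
    · rw [card_eq_one]
      exact ⟨A, by ext p; simp; rintro rfl; exact hq⟩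
    · rw [card_eq_zero]
      ext p; simp; rintro rfl; omega
  · rw [disjoint_left]
    intro p hp hp2
    simp only [mem_filter, mem_univ, true_and] at hp hp2
    obtain ⟨rfl, _⟩ := hp2
    omega

lemma rk_asc (w : Perm (Fin n)) {A B : Fin n} (h : (B : ℕ) = A + 1) (ha : w A < w B) (q : ℕ) :
    rk w B q = min (rk w A q + 1) (rk w (B+1) q) := by
  have h1 := rk_succ w A q
  have h2 := rk_succ w B q
  rw [← h] at h1
  have : (w A : ℕ) < w B := ha
  split_ifs at h1 h2 <;> omega

lemma rk_desc (w : Perm (Fin n)) {A B : Fin n} (h : (B : ℕ) = A + 1) (ha : w B < w A) (q : ℕ) :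
    rk w B q = max (rk w A q) (rk w (B+1) q - 1) := by
  have h1 := rk_succ w A q
  have h2 := rk_succ w B q
  rw [← h] at h1
  have : (w B : ℕ) < w A := ha
  split_ifs at h1 h2 <;> omega

lemma mul_swap_A (w : Perm (Fin n)) (A B : Fin n) : (w * swap A B) A = w B := by simp
lemma mul_swap_B (w : Perm (Fin n)) (A B : Fin n) : (w * swap A B) B = w A := by simp

lemma asc_mul (w : Perm (Fin n)) {A B : Fin n} :
    (w * swap A B) B < (w * swap A B) A ↔ w A < w B := by simp
lemma desc_mul (w : Perm (Fin n)) {A B : Fin n} :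
    (w * swap A B) A < (w * swap A B) B ↔ w B < w A := by simp

lemma mul_swap_swap (w : Perm (Fin n)) (A B : Fin n) : w * swap A B * swap A B = w := by
  rw [mul_assoc, swap_mul_self, mul_one]

lemma asc_or_desc (w : Perm (Fin n)) {A B : Fin n} (h : (B : ℕ) = A + 1) :
    w A < w B ∨ w B < w A := by
  have : w A ≠ w B := by
    intro hh
    have := w.injective hh
    subst this; omega
  exact lt_or_gt_of_ne this

lemma BD_refl (w : Perm (Fin n)) : BD w w := fun _ _ => le_rfl
lemma BD_trans {u v w : Perm (Fin n)} (h : BD u v) (h' : BD v w) : BD u w :=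
  fun i q => (h' i q).trans (h i q)

lemma BD_self_mul (w : Perm (Fin n)) {A B : Fin n} (h : (B : ℕ) = A + 1) (ha : w A < w B) :
    BD w (w * swap A B) := by
  intro i q
  by_cases hi : i = B
  · subst hi
    rw [rk_asc w h ha, rk_desc (w * swap A B) h (by simpa using ha),
      rk_mul_swap_ne w h _ _ (by omega), rk_mul_swap_ne w h _ _ (by omega)]
    have h1 := rk_succ w A q
    have h2 := rk_succ w B q
    rw [← h] at h1
    split_ifs at h1 h2 <;> omega
  · rw [rk_mul_swap_ne w h _ _ hi]

lemma BD_lift_asc {u w : Perm (Fin n)} {A B : Fin n} (h : (B : ℕ) = A + 1) (ha : w A < w B)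
    (hu : u A < u B) (hd : BD u (w * swap A B)) : BD u w := by
  intro i q
  by_cases hi : i = B
  · subst hi
    rw [rk_asc w h ha, rk_asc u h hu]
    have h1 := hd A q
    have h2 := hd (B+1) q
    rw [rk_mul_swap_ne w h _ _ (by omega)] at h1 h2
    omega
  · have := hd i q
    rwa [rk_mul_swap_ne w h _ _ hi] at this

lemma BD_mul_desc {u w : Perm (Fin n)} {A B : Fin n} (h : (B : ℕ) = A + 1) (ha : w A < w B)
    (hu : u B < u A) (hd : BD u (w * swap A B)) : BD (u * swap A B) w := by
  intro i q
  by_cases hi : i = B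
  · subst hi
    rw [rk_asc w h ha, rk_asc (u * swap A B) h (by simpa using hu)]
    have h1 := hd A q
    have h2 := hd (B+1) q
    rw [rk_mul_swap_ne w h _ _ (by omega)] at h1 h2
    rw [rk_mul_swap_ne u h _ _ (by omega), rk_mul_swap_ne u h _ _ (by omega)]
    omega
  · have := hd i q
    rw [rk_mul_swap_ne w h _ _ hi] at this
    rwa [rk_mul_swap_ne u h _ _ hi]

lemma BD_mul_mul {u w : Perm (Fin n)} {A B : Fin n} (h : (B : ℕ) = A + 1) (ha : w A < w B)
    (hu : u A < u B) (hd : BD u w) : BD (u * swap A B) (w * swap A B) := by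
  intro i q
  by_cases hi : i = B
  · subst hi
    rw [rk_desc (w * swap A B) h (by simpa using ha), rk_desc (u * swap A B) h (by simpa using hu)]
    have h1 := hd A q
    have h2 := hd (B+1) q
    rw [rk_mul_swap_ne u h _ _ (by omega), rk_mul_swap_ne u h _ _ (by omega),
      rk_mul_swap_ne w h _ _ (by omega), rk_mul_swap_ne w h _ _ (by omega)]
    omega
  · rw [rk_mul_swap_ne w h _ _ hi, rk_mul_swap_ne u h _ _ hi]
    exact hd i q

/-- recursion for the lower interval -/
lemma BD_mul_iff {u w : Perm (Fin n)} {A B : Fin n} (h : (B : ℕ) = A + 1) (ha : w A < w B) :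
    BD u (w * swap A B) ↔ BD u w ∨ BD (u * swap A B) w := by
  constructor
  · intro hd
    rcases asc_or_desc u h with hu | hu
    · exact Or.inl (BD_lift_asc h ha hu hd)
    · exact Or.inr (BD_mul_desc h ha hu hd)
  · rintro (hd | hd)
    · exact BD_trans hd (BD_self_mul w h ha)
    · rcases asc_or_desc u h with hu | hu
      · exact BD_trans (BD_trans (BD_self_mul u h hu) hd) (BD_self_mul w h ha)
      · have := BD_mul_mul h ha (u := u * swap A B) (by simpa using hu) hd
        rwa [mul_swap_swap] at this

/-! length -/

lemma swap_mono_ne {A B : Fin n} (h : (B : ℕ) = A + 1) {p q : Fin n} (hpq : p < q)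
    (hne : ¬ (p = A ∧ q = B)) : swap A B p < swap A B q := by
  have h1 : (p:ℕ) < q := hpq
  simp only [swap_apply_def]
  simp only [Fin.ext_iff] at hne
  split_ifs <;> simp only [Fin.ext_iff, Fin.lt_def] at * <;> omega

lemma invN_mul_swap (w : Perm (Fin n)) {A B : Fin n} (h : (B : ℕ) = A + 1) (ha : w A < w B) :
    invN (w * swap A B) = invN w + 1 := by
  unfold invN
  have hAB : A < B := by rw [Fin.lt_def]; omega
  have key : (univ.filter fun p : Fin n × Fin n => p.1 < p.2 ∧ (w * swap A B) p.2 < (w * swap A B) p.1)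
     = insert (A, B) ((univ.filter fun p : Fin n × Fin n => p.1 < p.2 ∧ w p.2 < w p.1).image
        (fun p => (swap A B p.1, swap A B p.2))) := by
    ext ⟨p, q⟩
    rw [mem_insert, mem_filter, mem_image]
    simp only [mem_filter]
    simp only [mem_univ, true_and, Prod.mk.injEq, Prod.exists]
    constructor
    · rintro ⟨hpq, hw⟩
      by_cases hh : p = A ∧ q = B
      · exact Or.inl hh
      · exact Or.inr ⟨swap A B p, swap A B q, ⟨swap_mono_ne h hpq hh, hw⟩, by simp, by simp⟩
    · rintro (⟨rfl, rfl⟩ | ⟨a, b, ⟨hab, hw⟩, rfl, rfl⟩)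
      · exact ⟨hAB, by simpa using ha⟩
      · refine ⟨swap_mono_ne h hab ?_, by simpa using hw⟩
        rintro ⟨rfl, rfl⟩
        exact absurd ha (not_lt.2 hw.le)
  rw [key, card_insert_of_notMem, card_image_of_injective]
  · intro x y hxy
    simp only [Prod.mk.injEq] at hxy
    exact Prod.ext ((swap A B).injective hxy.1) ((swap A B).injective hxy.2)
  · simp only [mem_image, mem_filter, mem_univ, true_and, Prod.mk.injEq, not_exists, not_and,
      Prod.forall]
    rintro a b ⟨hab, _⟩ h1 h2
    have h3 : a = B := by rw [← swap_apply_left A B, ← swap_apply_self A B a, h1, swap_apply_left]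
    have h4 : b = A := by rw [← swap_apply_right A B, ← swap_apply_self A B b, h2, swap_apply_right]
    subst h3; subst h4
    exact absurd hab (not_lt.2 hAB.le)

lemma invN_one : invN (1 : Perm (Fin n)) = 0 := by
  unfold invN
  rw [card_eq_zero]
  rw [filter_eq_empty_iff]
  rintro ⟨p, q⟩ - ⟨h1, h2⟩
  exact absurd h1 (not_lt.2 h2.le)

lemma exists_desc (w : Perm (Fin n)) (hw : w ≠ 1) :
    ∃ A B : Fin n, (B : ℕ) = A + 1 ∧ w B < w A := by
  by_contra hcon
  push Not at hcon
  apply hw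
  have hm : StrictMono w := by
    rcases n with _ | n
    · intro a; exact a.elim0
    rw [Fin.strictMono_iff_lt_succ]
    intro i
    refine lt_of_le_of_ne (hcon i.castSucc i.succ (by simp)) ?_
    intro hh
    have := w.injective hh
    simp [Fin.ext_iff] at this
  ext p
  have h1 : (hm.orderIsoOfSurjective w w.surjective) = OrderIso.refl (Fin n) := Subsingleton.elim _ _
  have := congrArg (fun f => f p) h1
  simp at this
  rw [this]; rfl

lemma exists_desc_factor (w : Perm (Fin n)) (hw : w ≠ 1) :
    ∃ A B : Fin n, ∃ w', (B : ℕ) = A + 1 ∧ w' A < w' B ∧ w = w' * swap A B := by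
  obtain ⟨A, B, h, hd⟩ := exists_desc w hw
  exact ⟨A, B, w * swap A B, h, by simpa using hd, (mul_swap_swap w A B).symm⟩

theorem perm_ind {P : Perm (Fin n) → Prop} (h1 : P 1)
    (hs : ∀ (w : Perm (Fin n)) (A B : Fin n), (B : ℕ) = A + 1 → w A < w B → P w → P (w * swap A B))
    (w : Perm (Fin n)) : P w := by
  induction hN : invN w using Nat.strong_induction_on generalizing w with
  | _ N ih =>
    by_cases hw : w = 1
    · rw [hw]; exact h1
    obtain ⟨A, B, w', h, ha, rfl⟩ := exists_desc_factor w hw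
    rw [invN_mul_swap w' h ha] at hN
    exact hs w' A B h ha (ih (invN w') (by omega) w' rfl)

lemma exists_word (w : Perm (Fin n)) :
    ∃ word : List ℕ, word.length = invN w ∧ (word.map (simpleT n)).prod = w := by
  induction w using perm_ind with
  | h1 => exact ⟨[], by simp [invN_one], by simp⟩
  | hs w A B h ha ih =>
    obtain ⟨word, h1, h2⟩ := ih
    refine ⟨word ++ [(B:ℕ)], by simp [h1, invN_mul_swap w h ha], ?_⟩
    simp [h2, simpleT_eq h]

lemma invN_mul_simpleT_le (w : Perm (Fin n)) (i : ℕ) : invN (w * simpleT n i) ≤ invN w + 1 := by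
  rcases simpleT_cases n i with h | ⟨A, B, h, _, h'⟩
  · rw [h]; simp
  · rw [h']
    rcases asc_or_desc w h with ha | ha
    · rw [invN_mul_swap w h ha]
    · have := invN_mul_swap (w * swap A B) h (by simpa using ha)
      rw [mul_swap_swap] at this
      omega

lemma invN_le_word (word : List ℕ) : invN (word.map (simpleT n)).prod ≤ word.length := by
  induction word using List.reverseRecOn with
  | nil => simp [invN_one]
  | append_singleton l a ih =>
    simp only [List.map_append, List.map_cons, List.map_nil, List.prod_append, List.prod_cons,
      List.prod_nil, mul_one, List.length_append, List.length_cons, List.length_nil]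
    exact (invN_mul_simpleT_le _ _).trans (by omega)

theorem permLen_eq (w : Perm (Fin n)) : permLen n w = invN w := by
  unfold permLen
  apply le_antisymm
  · exact Nat.sInf_le (exists_word w)
  · refine le_csInf ⟨_, exists_word w⟩ ?_
    rintro l ⟨word, rfl, rfl⟩
    exact invN_le_word word

lemma exists_reduced (w : Perm (Fin n)) : ∃ word, IsReducedWord n word w := by
  obtain ⟨word, h1, h2⟩ := exists_word w
  exact ⟨word, h2, by rw [permLen_eq, h1]⟩

lemma reduced_append {l : List ℕ} {a : ℕ} {w : Perm (Fin n)} (h : IsReducedWord n (l ++ [a]) w) :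
    ∃ A B : Fin n, ∃ w', (B : ℕ) = A + 1 ∧ a = B ∧ w' A < w' B ∧ w = w' * swap A B ∧
      IsReducedWord n l w' := by
  obtain ⟨h1, h2⟩ := h
  rw [permLen_eq] at h2
  simp only [List.map_append, List.map_cons, List.map_nil, List.prod_append, List.prod_cons,
      List.prod_nil, mul_one, List.length_append, List.length_cons, List.length_nil] at h1 h2
  have hl := invN_le_word (n := n) l
  rcases simpleT_cases n a with h | ⟨A, B, h, hB, h'⟩
  · rw [h, mul_one] at h1
    rw [← h1] at h2
    omega
  · rw [h'] at h1
    rcases asc_or_desc (List.map (simpleT n) l).prod h with ha | ha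
    · refine ⟨A, B, _, h, hB, ha, h1.symm, rfl, ?_⟩
      rw [permLen_eq]
      rw [← h1, invN_mul_swap _ h ha] at h2
      omega
    · have := invN_mul_swap ((List.map (simpleT n) l).prod * swap A B) h (by simpa using ha)
      rw [mul_swap_swap, h1] at this
      omega

lemma reduced_snoc {l : List ℕ} {w : Perm (Fin n)} {A B : Fin n} (h : (B : ℕ) = A + 1)
    (ha : w A < w B) (hl : IsReducedWord n l w) : IsReducedWord n (l ++ [(B:ℕ)]) (w * swap A B) := by
  obtain ⟨h1, h2⟩ := hl
  refine ⟨by simp [h1, simpleT_eq h], ?_⟩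
  rw [permLen_eq] at *
  simp [h2, invN_mul_swap w h ha]

lemma BD_of_sublist (lw : List ℕ) : ∀ (lu : List ℕ) (u w : Perm (Fin n)), IsReducedWord n lu u →
    IsReducedWord n lw w → lu.Sublist lw → BD u w := by
  induction lw using List.reverseRecOn with
  | nil =>
    intro lu u w hu hw hs
    rw [List.sublist_nil] at hs
    subst hs
    rw [← hu.1, ← hw.1]
    exact BD_refl _
  | append_singleton l a ih =>
    intro lu u w hu hw hs
    obtain ⟨A, B, w', h, hB, ha, rfl, hl⟩ := reduced_append hw
    rw [List.sublist_append_iff] at hs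
    obtain ⟨l1, l2, rfl, hs1, hs2⟩ := hs
    rw [BD_mul_iff h ha]
    rw [List.sublist_singleton] at hs2
    rcases hs2 with rfl | rfl
    · rw [List.append_nil] at hu
      exact Or.inl (ih _ _ _ hu hl hs1)
    · obtain ⟨A', B', u', h', hB', ha', rfl, hl'⟩ := reduced_append hu
      have e1 : B' = B := by ext; omega
      subst e1
      have e2 : A' = A := by ext; omega
      subst e2
      right
      rw [mul_swap_swap]
      exact ih _ _ _ hl' hl hs1

lemma sublist_of_BD (w : Perm (Fin n)) : ∀ u, BD u w → ∃ lu lw, IsReducedWord n lu u ∧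
    IsReducedWord n lw w ∧ lu.Sublist lw := by
  suffices ∃ lw, IsReducedWord n lw w ∧ ∀ u, BD u w → ∃ lu, IsReducedWord n lu u ∧ lu.Sublist lw by
    obtain ⟨lw, h1, h2⟩ := this
    intro u hu
    obtain ⟨lu, h3, h4⟩ := h2 u hu
    exact ⟨lu, lw, h3, h1, h4⟩
  induction w using perm_ind with
  | h1 =>
    refine ⟨[], ⟨by simp, by simp [permLen_eq, invN_one]⟩, ?_⟩
    intro u hu
    suffices u = 1 by
      subst this
      exact ⟨[], ⟨by simp, by simp [permLen_eq, invN_one]⟩, List.Sublist.refl _⟩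
    by_contra hne
    obtain ⟨A, B, h, hd⟩ := exists_desc u hne
    have hA : ∀ (v : Perm (Fin n)) (i : ℕ) (q : ℕ), rk v i q ≤ i := by
      intro v i q
      unfold rk
      calc _ ≤ (univ.filter fun p : Fin n => p.val < i).card := by
            apply card_le_card
            intro p; simp; intro h _; exact h
        _ ≤ (range i).card := by
            apply card_le_card_of_injOn (fun p => p.val)
            · intro p hp; simpa using hp
            · intro p _ q _ h; exact Fin.ext h
        _ = i := by simp
    have hB : ∀ (i : ℕ), i ≤ n → rk (1 : Perm (Fin n)) i i = i := by
      intro i hi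
      unfold rk
      have : (univ.filter fun p : Fin n => p.val < i ∧ ((1 : Perm (Fin n)) p).val < i)
        = univ.filter fun p : Fin n => p.val < i := by ext p; simp
      rw [this]
      rw [Fin.card_filter_val_lt]
      omega
    -- all rows
    have hC : ∀ p : Fin n, ∀ q : Fin n, q ≤ p → u q ≤ p := by
      intro p
      have e := hu (p+1) (p+1)
      rw [hB _ p.2] at e
      have e2 : rk u (p+1) (p+1) = (univ.filter fun q : Fin n => q.val < (p:ℕ)+1).card := by
        rw [Fin.card_filter_val_lt]
        have := hA u (p+1) (p+1)
        omega
      unfold rk at e2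
      have e3 := eq_of_subset_of_card_le (s := univ.filter fun q : Fin n => q.val < (p:ℕ)+1 ∧ (u q).val < (p:ℕ)+1)
        (t := univ.filter fun q : Fin n => q.val < (p:ℕ)+1) (by intro q; simp; intro h _; exact h) e2.ge
      intro q hq
      have : q ∈ univ.filter fun q : Fin n => q.val < (p:ℕ)+1 := by
        simp only [mem_filter, mem_univ, true_and]; exact Nat.lt_succ_of_le hq
      rw [← e3, mem_filter] at this
      exact Nat.lt_succ_iff.1 this.2.2
    have hid : ∀ m : ℕ, ∀ p : Fin n, (p : ℕ) = m → u p = p := by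
      intro m
      induction m using Nat.strong_induction_on with
      | _ m ih =>
        intro p hp
        have := hC p p le_rfl
        rcases this.lt_or_eq with hlt | heq
        · have e := ih (u p) (by rw [← hp]; exact hlt) (u p) rfl
          exact absurd (u.injective e) hlt.ne
        · exact heq
    rw [hid _ A rfl, hid _ B rfl] at hd
    have : (B:ℕ) < A := hd
    omega
  | hs w A B h ha ih =>
    obtain ⟨lw, h1, h2⟩ := ih
    refine ⟨lw ++ [(B:ℕ)], reduced_snoc h ha h1, ?_⟩
    intro u hu
    rcases asc_or_desc u h with hu' | hu'
    · obtain ⟨lu, h3, h4⟩ := h2 u (BD_lift_asc h ha hu' hu)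
      exact ⟨lu, h3, h4.trans (List.sublist_append_left _ _)⟩
    · obtain ⟨lu, h3, h4⟩ := h2 _ (BD_mul_desc h ha hu' hu)
      refine ⟨lu ++ [(B:ℕ)], ?_, h4.append (List.Sublist.refl _)⟩
      have := reduced_snoc h (by simpa using hu') h3
      rwa [mul_swap_swap] at this

theorem bruhat_iff (u w : Perm (Fin n)) : bruhatLE n u w ↔ BD u w := by
  constructor
  · rintro ⟨lu, lw, h1, h2, h3⟩
    exact BD_of_sublist lw lu u w h1 h2 h3
  · intro h
    exact sublist_of_BD w u h

lemma one_bruhat (u : Perm (Fin n)) : bruhatLE n 1 u := by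
  obtain ⟨l, hl⟩ := exists_reduced u
  exact ⟨[], l, ⟨by simp, by simp [permLen_eq, invN_one]⟩, hl, List.nil_sublist _⟩

theorem BIP_eq (w : Perm (Fin n)) : BIP n 1 w = convexHull ℝ (permPoint n '' {u | BD u w}) := by
  unfold BIP
  congr 1
  ext x
  simp only [Set.mem_ofPred_eq, Set.mem_image, bruhat_iff]
  constructor
  · rintro ⟨u, _, h, rfl⟩; exact ⟨u, h, rfl⟩
  · rintro ⟨u, h, rfl⟩; exact ⟨u, (bruhat_iff _ _).1 (one_bruhat u), h, rfl⟩

end CombPart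


section CombPart2
open Equiv Finset

variable {n : ℕ}

/-- `w` preserves the first `i` positions -/
def Pres (w : Perm (Fin n)) (i : ℕ) : Prop := ∀ p : Fin n, p.val < i → (w p).val < i

instance (w : Perm (Fin n)) (i : ℕ) : Decidable (Pres w i) := by unfold Pres; infer_instance

/-- support -/
def Jset (w : Perm (Fin n)) : Finset ℕ := (range n).filter fun i => ¬ Pres w i

lemma mem_Jset (w : Perm (Fin n)) (i : ℕ) : i ∈ Jset w ↔ i < n ∧ ¬ Pres w i := by
  unfold Jset; rw [mem_filter, mem_range]

lemma Pres_ge {w : Perm (Fin n)} {i : ℕ} (h : Pres w i) (p : Fin n) (hp : i ≤ p) :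
    i ≤ (w p : ℕ) := by
  by_contra hcon
  push Not at hcon
  have himg : (univ.filter fun q : Fin n => q.val < i).image w =
      univ.filter fun q : Fin n => q.val < i := by
    apply eq_of_subset_of_card_le
    · intro x hx
      rw [mem_image] at hx
      obtain ⟨y, hy, rfl⟩ := hx
      rw [mem_filter] at hy ⊢
      exact ⟨mem_univ _, h y hy.2⟩
    · rw [card_image_of_injective _ w.injective]
  have : w p ∈ univ.filter fun q : Fin n => q.val < i := by
    rw [mem_filter]; exact ⟨mem_univ _, hcon⟩
  rw [← himg, mem_image] at this
  obtain ⟨y, hy, hyp⟩ := this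
  rw [mem_filter] at hy
  have := w.injective hyp
  subst this
  omega

lemma exists_of_not_Pres {w : Perm (Fin n)} {i : ℕ} (h : ¬ Pres w i) :
    ∃ q : Fin n, i ≤ q ∧ (w q : ℕ) < i := by
  by_contra hcon
  push Not at hcon
  apply h
  have h1 : Pres w⁻¹ i := by
    intro p hp
    by_contra hc
    push Not at hc
    have := hcon _ hc
    simp at this
    omega
  intro p hp
  by_contra hc
  push Not at hc
  have := Pres_ge h1 _ hc
  simp at this
  omega

lemma Pres_mul_ne (w : Perm (Fin n)) {A B : Fin n} (h : (B : ℕ) = A + 1) (i : ℕ) (hi : i ≠ B) :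
    Pres (w * swap A B) i ↔ Pres w i := by
  constructor
  · intro hp p hpi
    have := hp (swap A B p) ((swap_lt_iff h p i hi).2 hpi)
    simpa using this
  · intro hp p hpi
    exact hp (swap A B p) ((swap_lt_iff h p i hi).2 hpi)

lemma not_Pres_mul (w : Perm (Fin n)) {A B : Fin n} (h : (B : ℕ) = A + 1) (ha : w A < w B) :
    ¬ Pres (w * swap A B) B := by
  intro hp
  have h1 := hp A (by omega)
  have h2 := Pres_ge hp B le_rfl
  rw [mul_swap_A] at h1
  rw [mul_swap_B] at h2
  have : (w A : ℕ) < w B := ha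
  omega

lemma Jset_mul (w : Perm (Fin n)) {A B : Fin n} (h : (B : ℕ) = A + 1) (ha : w A < w B) :
    Jset (w * swap A B) = insert (B : ℕ) (Jset w) := by
  ext i
  rw [mem_insert, mem_Jset, mem_Jset]
  by_cases hi : i = B
  · subst hi
    simp [not_Pres_mul w h ha]
  · rw [Pres_mul_ne w h i hi]; simp [hi]

lemma rk_le_left (v : Perm (Fin n)) (i q : ℕ) : rk v i q ≤ i := by
  unfold rk
  calc _ ≤ (univ.filter fun p : Fin n => p.val < i).card := by
        apply card_le_card
        intro p; simp; intro h _; exact h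
    _ ≤ (range i).card := by
        apply card_le_card_of_injOn (fun p => p.val)
        · intro p hp; simpa using hp
        · intro p _ q _ h; exact Fin.ext h
    _ = i := by simp

lemma rk_eq_of (v : Perm (Fin n)) {i q : ℕ} (hi : i ≤ n) (h : ∀ p : Fin n, p.val < i → (v p).val < q) :
    rk v i q = i := by
  unfold rk
  have : (univ.filter fun p : Fin n => p.val < i ∧ (v p).val < q)
    = univ.filter fun p : Fin n => p.val < i := by
    ext p; rw [mem_filter, mem_filter]
    constructor
    · rintro ⟨_, h1, _⟩; exact ⟨mem_univ _, h1⟩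
    · rintro ⟨_, h1⟩; exact ⟨mem_univ _, h1, h p h1⟩
  rw [this, Fin.card_filter_val_lt]
  omega

lemma of_rk_eq (v : Perm (Fin n)) {i q : ℕ} (hi : i ≤ n) (h : i ≤ rk v i q) :
    ∀ p : Fin n, p.val < i → (v p).val < q := by
  unfold rk at h
  have e3 := eq_of_subset_of_card_le (s := univ.filter fun p : Fin n => p.val < i ∧ (v p).val < q)
    (t := univ.filter fun p : Fin n => p.val < i) (by intro q; simp; intro h _; exact h)
    (by rw [Fin.card_filter_val_lt]; omega)
  intro p hp
  have : p ∈ univ.filter fun q : Fin n => q.val < i := by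
    rw [mem_filter]; exact ⟨mem_univ _, hp⟩
  rw [← e3, mem_filter] at this
  exact this.2.2

lemma BD_Pres {u w : Perm (Fin n)} (hd : BD u w) {i : ℕ} (hi : i ≤ n) (h : Pres w i) : Pres u i := by
  apply of_rk_eq u hi
  have := hd i i
  rwa [rk_eq_of w hi h] at this

lemma Jset_mono {u w : Perm (Fin n)} (hd : BD u w) : Jset u ⊆ Jset w := by
  intro i hi
  rw [mem_Jset] at hi ⊢
  exact ⟨hi.1, fun h => hi.2 (BD_Pres hd hi.1.le h)⟩

lemma Jset_one : Jset (1 : Perm (Fin n)) = ∅ := by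
  ext i
  rw [mem_Jset]
  simp [Pres]

lemma card_Jset_le (w : Perm (Fin n)) : (Jset w).card ≤ invN w := by
  induction w using perm_ind with
  | h1 => simp [Jset_one]
  | hs w A B h ha ih =>
    rw [Jset_mul w h ha, invN_mul_swap w h ha]
    exact (card_insert_le _ _).trans (by omega)

/-- 321 occurrence -/
def T3 (w : Perm (Fin n)) (p q r : Fin n) : Prop := p < q ∧ q < r ∧ w q < w p ∧ w r < w q
/-- 3412 occurrence -/
def F4 (w : Perm (Fin n)) (p q r t : Fin n) : Prop :=
  p < q ∧ q < r ∧ r < t ∧ w r < w t ∧ w t < w p ∧ w p < w q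

lemma descent_lemma (w : Perm (Fin n)) {A B : Fin n} (h : (B : ℕ) = A + 1) (hd : w B < w A)
    (hP : ¬ Pres (w * swap A B) B) :
    (∃ d, T3 w d A B ∨ T3 w A B d) ∨ ∃ p t, F4 w p A B t := by
  have hq := exists_of_not_Pres hP
  unfold Pres at hP
  push Not at hP
  obtain ⟨p, hp, hp2⟩ := hP
  obtain ⟨q, hq, hq2⟩ := hq
  rcases eq_or_ne p A with rfl | hpA
  · rw [mul_swap_A] at hp2
    left
    rcases eq_or_ne q B with rfl | hqB
    · rw [mul_swap_B] at hq2
      grind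
    · rw [Perm.mul_apply, swap_apply_of_ne_of_ne (by grind) hqB] at hq2
      exact ⟨q, Or.inr ⟨by grind, by grind, hd, by grind⟩⟩
  · rw [Perm.mul_apply, swap_apply_of_ne_of_ne hpA (by grind)] at hp2
    rcases eq_or_ne q B with rfl | hqB
    · rw [mul_swap_B] at hq2
      left
      exact ⟨p, Or.inl ⟨by grind, by grind, by grind, hd⟩⟩
    · rw [Perm.mul_apply, swap_apply_of_ne_of_ne (by grind) hqB] at hq2
      by_cases h1 : w A < w p
      · left; exact ⟨p, Or.inl ⟨by grind, by grind, h1, hd⟩⟩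
      by_cases h2 : w q < w B
      · left; exact ⟨q, Or.inr ⟨by grind, by grind, hd, h2⟩⟩
      right
      have h3 : w p ≠ w A := fun hh => hpA (w.injective hh)
      have h4 : w q ≠ w B := fun hh => hqB (w.injective hh)
      exact ⟨p, q, by grind, by grind, by grind, by grind, by grind, by grind⟩

/- transport, `w` has a descent at `A, B` and `w * swap A B` is the smaller one -/

lemma T3_up {w : Perm (Fin n)} {A B : Fin n} (h : (B : ℕ) = A + 1) (ha : w A < w B) {p q r : Fin n}
    (ht : T3 w p q r) : T3 (w * swap A B) (swap A B p) (swap A B q) (swap A B r) := by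
  obtain ⟨h1, h2, h3, h4⟩ := ht
  refine ⟨swap_mono_ne h h1 (by grind), swap_mono_ne h h2 (by grind), by simpa using h3,
    by simpa using h4⟩

lemma T3_down {w : Perm (Fin n)} {A B : Fin n} (h : (B : ℕ) = A + 1) {p q r : Fin n}
    (ht : T3 w p q r) (hn : ¬ ((p = A ∧ q = B) ∨ (q = A ∧ r = B))) :
    T3 (w * swap A B) (swap A B p) (swap A B q) (swap A B r) := by
  obtain ⟨h1, h2, h3, h4⟩ := ht
  refine ⟨swap_mono_ne h h1 (by tauto), swap_mono_ne h h2 (by tauto), by simpa using h3,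
    by simpa using h4⟩

lemma F4_up {w : Perm (Fin n)} {A B : Fin n} (h : (B : ℕ) = A + 1) (ha : w A < w B) {p q r t : Fin n}
    (ht : F4 w p q r t) : F4 (w * swap A B) (swap A B p) (swap A B q) (swap A B r) (swap A B t) ∨
      (∃ x y, x ≠ y ∧ T3 (w * swap A B) A B x ∧ T3 (w * swap A B) A B y) ∨
      (∃ x y, x ≠ y ∧ T3 (w * swap A B) x A B ∧ T3 (w * swap A B) y A B) := by
  obtain ⟨h1, h2, h3, h4, h5, h6⟩ := ht
  have hAB : A < B := by rw [Fin.lt_def]; omega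
  by_cases c1 : p = A ∧ q = B
  · right; left
    obtain ⟨rfl, rfl⟩ := c1
    have e1 : (w * swap p q) r = w r := by
      rw [Perm.mul_apply, swap_apply_of_ne_of_ne (by grind) (by grind)]
    have e2 : (w * swap p q) t = w t := by
      rw [Perm.mul_apply, swap_apply_of_ne_of_ne (by grind) (by grind)]
    refine ⟨r, t, h3.ne, ⟨hAB, h2, ?_, ?_⟩, ⟨hAB, h2.trans h3, ?_, ?_⟩⟩ <;>
      simp only [mul_swap_A, mul_swap_B, e1, e2] <;> grind
  by_cases c2 : r = A ∧ t = B
  · right; right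
    obtain ⟨rfl, rfl⟩ := c2
    have e1 : (w * swap r t) p = w p := by
      rw [Perm.mul_apply, swap_apply_of_ne_of_ne (by grind) (by grind)]
    have e2 : (w * swap r t) q = w q := by
      rw [Perm.mul_apply, swap_apply_of_ne_of_ne (by grind) (by grind)]
    refine ⟨p, q, h1.ne, ⟨h1.trans h2, hAB, ?_, ?_⟩, ⟨h2, hAB, ?_, ?_⟩⟩ <;>
      simp only [mul_swap_A, mul_swap_B, e1, e2] <;> grind
  left
  refine ⟨swap_mono_ne h h1 c1, swap_mono_ne h h2 (by grind), swap_mono_ne h h3 c2, ?_, ?_, ?_⟩ <;>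
    simpa

lemma F4_down {w : Perm (Fin n)} {A B : Fin n} (h : (B : ℕ) = A + 1) (hd : w B < w A)
    {p q r t : Fin n} (ht : F4 w p q r t) (hn : ¬ (q = A ∧ r = B)) :
    F4 (w * swap A B) (swap A B p) (swap A B q) (swap A B r) (swap A B t) := by
  obtain ⟨h1, h2, h3, h4, h5, h6⟩ := ht
  refine ⟨swap_mono_ne h h1 (by grind), swap_mono_ne h h2 hn, swap_mono_ne h h3 (by grind), ?_, ?_, ?_⟩ <;>
    simpa

def C0 (w : Perm (Fin n)) : Prop := (∀ p q r, ¬ T3 w p q r) ∧ (∀ p q r t, ¬ F4 w p q r t)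
def C1 (w : Perm (Fin n)) : Prop :=
  (∃ p q r, T3 w p q r ∧ ∀ p' q' r', T3 w p' q' r' → p' = p ∧ q' = q ∧ r' = r) ∧
    (∀ p q r t, ¬ F4 w p q r t)

lemma C0_down {w : Perm (Fin n)} {A B : Fin n} (h : (B : ℕ) = A + 1) (ha : w A < w B)
    (hc : C0 (w * swap A B)) : C0 w := by
  refine ⟨fun p q r ht => hc.1 _ _ _ (T3_up h ha ht), fun p q r t ht => ?_⟩
  rcases F4_up h ha ht with h1 | ⟨x, y, _, h1, _⟩ | ⟨x, y, _, h1, _⟩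
  · exact hc.2 _ _ _ _ h1
  · exact hc.1 _ _ _ h1
  · exact hc.1 _ _ _ h1

lemma C0_factor (w : Perm (Fin n)) (hc : C0 w) : w = 1 ∨ ∃ A B : Fin n, ∃ w' : Perm (Fin n),
    (B : ℕ) = A + 1 ∧ w' A < w' B ∧ w = w' * swap A B ∧ Pres w' B ∧ C0 w' := by
  by_cases hw : w = 1
  · exact Or.inl hw
  right
  obtain ⟨A, B, h, hd⟩ := exists_desc w hw
  refine ⟨A, B, w * swap A B, h, by simpa using hd, (mul_swap_swap w A B).symm, ?_, ?_⟩
  · by_contra hP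
    rcases descent_lemma w h hd hP with ⟨d, h1 | h1⟩ | ⟨p, t, h1⟩
    · exact hc.1 _ _ _ h1
    · exact hc.1 _ _ _ h1
    · exact hc.2 _ _ _ _ h1
  · apply C0_down h (by simpa using hd)
    rwa [mul_swap_swap]

lemma exists_desc_between (w : Perm (Fin n)) {p q : Fin n} (hpq : p < q) (hw : w q < w p) :
    ∃ A B : Fin n, (B : ℕ) = A + 1 ∧ w B < w A ∧ p ≤ A ∧ B ≤ q := by
  by_contra hcon
  push Not at hcon
  have : ∀ m : ℕ, ∀ x : Fin n, (x : ℕ) = p + m → x ≤ q → w p ≤ w x := by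
    intro m
    induction m with
    | zero => intro x hx _; have : x = p := Fin.ext (by omega); rw [this]
    | succ m ih =>
      intro x hx hxq
      have e := ih ⟨p + m, by omega⟩ rfl (by rw [Fin.le_def] at *; simp; omega)
      by_contra hc
      push Not at hc
      have := hcon ⟨p + m, by omega⟩ x (by simp; omega) (lt_of_lt_of_le hc e)
        (by rw [Fin.le_def]; simp)
      exact absurd hxq (not_le.2 this)
  have h1 : (p : ℕ) < q := hpq
  exact absurd (this (q - p) q (by omega) le_rfl) (not_le.2 hw)

lemma C1_factor (w : Perm (Fin n)) (hc : C1 w) :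
    (∃ A B : Fin n, ∃ w' : Perm (Fin n),
      (B : ℕ) = A + 1 ∧ w' A < w' B ∧ w = w' * swap A B ∧ Pres w' B ∧ C1 w') ∨
    (∃ A B C : Fin n, ∃ x : Perm (Fin n), (B : ℕ) = A + 1 ∧ (C : ℕ) = B + 1 ∧
      x A < x B ∧ x B < x C ∧ Pres x B ∧ Pres x C ∧ C0 x ∧
      w = x * swap A B * swap B C * swap A B) := by
  obtain ⟨⟨p, q, r, hT, huniq⟩, hF⟩ := hc
  by_cases hex : ∃ A B : Fin n, (B : ℕ) = A + 1 ∧ w B < w A ∧ ¬ ((p = A ∧ q = B) ∨ (q = A ∧ r = B))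
  · left
    obtain ⟨A, B, h, hd, hnot⟩ := hex
    have ha : (w * swap A B) A < (w * swap A B) B := by simpa using hd
    refine ⟨A, B, w * swap A B, h, ha, (mul_swap_swap w A B).symm, ?_, ?_⟩
    · by_contra hP
      rcases descent_lemma w h hd hP with ⟨d, h1 | h1⟩ | ⟨p, t, h1⟩
      · have := huniq _ _ _ h1; grind
      · have := huniq _ _ _ h1; grind
      · exact hF _ _ _ _ h1
    · refine ⟨⟨_, _, _, T3_down h hT hnot, ?_⟩, ?_⟩
      · intro p' q' r' h'
        have := T3_up h ha h'
        rw [mul_swap_swap] at this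
        obtain ⟨e1, e2, e3⟩ := huniq _ _ _ this
        rw [← e1, ← e2, ← e3]
        simp
      · intro a b c d h'
        have := F4_up h ha h'
        rw [mul_swap_swap] at this
        rcases this with h1 | ⟨x, y, hne, h1, h2⟩ | ⟨x, y, hne, h1, h2⟩
        · exact hF _ _ _ _ h1
        · have := huniq _ _ _ h1
          have := huniq _ _ _ h2
          grind
        · have := huniq _ _ _ h1
          have := huniq _ _ _ h2
          grind
  · right
    push Not at hex
    have hT' := hT
    obtain ⟨h1, h2, h3, h4⟩ := hT'
    obtain ⟨A, B, h, hd, hpA, hBq⟩ := exists_desc_between w h1 h3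
    have e1 := hex A B h hd
    have e1' : p = A ∧ q = B := by grind
    obtain ⟨rfl, rfl⟩ := e1'
    obtain ⟨B', C, h', hd', hpA', hBq'⟩ := exists_desc_between w h2 h4
    have e2 := hex B' C h' hd'
    have e2' : q = B' ∧ r = C := by grind
    obtain ⟨rfl, rfl⟩ := e2'
    -- positions p, q, r consecutive
    set x := w * swap p q * swap q r * swap p q with hx
    have hpq : p ≠ q := h1.ne
    have hqr : q ≠ r := h2.ne
    have hpr : p ≠ r := (h1.trans h2).ne
    have xp : x p = w r := by
      simp [hx, Perm.mul_apply, swap_apply_of_ne_of_ne hpr.symm hqr.symm]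
    have xq : x q = w q := by
      simp [hx, Perm.mul_apply, swap_apply_of_ne_of_ne hpq hpr]
    have xr : x r = w p := by
      simp [hx, Perm.mul_apply, swap_apply_of_ne_of_ne hpr.symm hqr.symm]
    have xo : ∀ z, z ≠ p → z ≠ q → z ≠ r → x z = w z := by
      intro z z1 z2 z3
      simp [hx, Perm.mul_apply, swap_apply_of_ne_of_ne z1 z2, swap_apply_of_ne_of_ne z2 z3]
    have hlo : ∀ z, z < q → x z < w q := by
      intro z hz
      rcases eq_or_ne z p with rfl | hzp
      · rw [xp]; exact h4
      · rw [xo z hzp (by grind) (by grind)]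
        by_contra hcon
        have hne : w z ≠ w q := fun hh => by have := w.injective hh; grind
        have := huniq z q r ⟨hz, h2, by grind, h4⟩
        grind
    have hhi : ∀ z, q < z → w q < x z := by
      intro z hz
      rcases eq_or_ne z r with rfl | hzp
      · rw [xr]; exact h3
      · rw [xo z (by grind) (by grind) hzp]
        by_contra hcon
        have hne : w z ≠ w q := fun hh => by have := w.injective hh; grind
        have := huniq p q z ⟨h1, hz, by grind, by grind⟩
        grind
    -- value of `w q` is `q`
    have hval : (w q : ℕ) = q := by
      have hset : (univ.filter fun z : Fin n => (x z : ℕ) < (w q : ℕ)) =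
          univ.filter fun z : Fin n => (z : ℕ) < q := by
        ext z
        rw [mem_filter, mem_filter]
        simp only [mem_univ, true_and]
        constructor
        · intro hz
          by_contra hcon
          rcases eq_or_ne z q with rfl | hne
          · rw [xq] at hz; omega
          · have := hhi z (by grind)
            grind
        · intro hz
          exact hlo z hz
      have hc1 : (univ.filter fun z : Fin n => (x z : ℕ) < (w q : ℕ)).card = (w q : ℕ) := by
        have : (univ.filter fun z : Fin n => (x z : ℕ) < (w q : ℕ)) =
          (univ.filter fun z : Fin n => (z : ℕ) < (w q : ℕ)).image (⇑(x⁻¹)) := by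
          ext z
          rw [mem_filter, mem_image]
          constructor
          · rintro ⟨_, hz⟩
            exact ⟨x z, by rw [mem_filter]; exact ⟨mem_univ _, hz⟩, by simp⟩
          · rintro ⟨y, hy, rfl⟩
            rw [mem_filter] at hy
            exact ⟨mem_univ _, by simpa using hy.2⟩
        rw [this, card_image_of_injective _ (x⁻¹).injective, Fin.card_filter_val_lt]
        omega
      rw [hset, Fin.card_filter_val_lt] at hc1
      omega
    refine ⟨p, q, r, x, h, h', by rw [xp, xq]; exact h4, by rw [xr, xq]; exact h3, ?_, ?_, ?_, ?_⟩
    · intro z hz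
      have := hlo z hz
      rw [Fin.lt_def] at this; omega
    · intro z hz
      rcases eq_or_ne z q with rfl | hne
      · rw [xq]; omega
      · have := hlo z (by grind)
        rw [Fin.lt_def] at this; omega
    · -- C0 x
      have c1 : C0 (w * swap p q) := by
        have ha : (w * swap p q) p < (w * swap p q) q := by simpa using h3
        refine ⟨?_, ?_⟩
        · intro a b c hT'
          have := T3_up h ha hT'
          rw [mul_swap_swap] at this
          obtain ⟨e1, e2, e3⟩ := huniq _ _ _ this
          have e1' : a = q := by rw [← swap_apply_self p q a, e1, swap_apply_left]
          have e2' : b = p := by rw [← swap_apply_self p q b, e2, swap_apply_right]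
          have := hT'.1
          grind
        · intro a b c d hF'
          have := F4_up h ha hF'
          rw [mul_swap_swap] at this
          rcases this with h1 | ⟨x, y, hne, h1, h2⟩ | ⟨x, y, hne, h1, h2⟩
          · exact hF _ _ _ _ h1
          · have := huniq _ _ _ h1
            have := huniq _ _ _ h2
            grind
          · have := huniq _ _ _ h1
            have := huniq _ _ _ h2
            grind
      have c2 : C0 (w * swap p q * swap q r) := by
        apply C0_down h' (A := q) (B := r)
        · simp [Perm.mul_apply, swap_apply_of_ne_of_ne hpr.symm hqr.symm]
          exact h4.trans h3
        · rwa [mul_swap_swap]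
      apply C0_down h (A := p) (B := q)
      · rw [xp, xq]; exact h4
      · rw [hx, mul_swap_swap]; exact c2
    · rw [hx, mul_swap_swap, mul_swap_swap, mul_swap_swap]

end CombPart2


section CombPart3
open Equiv Finset

variable {n : ℕ}

lemma mul_swap_ne (w : Perm (Fin n)) {A B z : Fin n} (h1 : z ≠ A) (h2 : z ≠ B) :
    (w * swap A B) z = w z := by
  rw [Perm.mul_apply, swap_apply_of_ne_of_ne h1 h2]

lemma bridge_T3 {w : Perm (Fin n)} {A B : Fin n} (h : (B : ℕ) = A + 1) (hP : Pres w B)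
    {p q r : Fin n} (ht : T3 (w * swap A B) p q r) : ¬ ((p = A ∧ q = B) ∨ (q = A ∧ r = B)) := by
  obtain ⟨h1, h2, h3, h4⟩ := ht
  have hA := hP A (by omega)
  have hB := Pres_ge hP B le_rfl
  rw [Fin.lt_def] at h1 h2 h3 h4
  rintro (⟨rfl, rfl⟩ | ⟨rfl, rfl⟩)
  · have hr := Pres_ge hP r (by omega)
    rw [mul_swap_B, mul_swap_ne w (by grind) (by grind)] at h4
    omega
  · have hr := hP p (by omega)
    rw [mul_swap_A, mul_swap_ne w (by grind) (by grind)] at h3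
    omega

lemma bridge_F4 {w : Perm (Fin n)} {A B : Fin n} (h : (B : ℕ) = A + 1) (hP : Pres w B)
    {p q r t : Fin n} (ht : F4 (w * swap A B) p q r t) : ¬ (q = A ∧ r = B) := by
  obtain ⟨h1, h2, h3, h4, h5, h6⟩ := ht
  rintro ⟨rfl, rfl⟩
  rw [Fin.lt_def] at h1 h2 h3 h4 h5 h6
  have hr := hP p (by omega)
  have hr' := Pres_ge hP t (by omega)
  rw [mul_swap_ne w (by grind) (by grind), mul_swap_ne w (by grind) (by grind)] at h5
  omega

lemma bridge_F4_all {w : Perm (Fin n)} {A B : Fin n} (h : (B : ℕ) = A + 1) (ha : w A < w B)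
    (hP : Pres w B) (hF : ∀ p q r t, ¬ F4 w p q r t) :
    ∀ p q r t, ¬ F4 (w * swap A B) p q r t := by
  intro p q r t ht
  have := F4_down h (by simpa using ha) ht (bridge_F4 h hP ht)
  rw [mul_swap_swap] at this
  exact hF _ _ _ _ this

lemma bridge_C0 {w : Perm (Fin n)} {A B : Fin n} (h : (B : ℕ) = A + 1) (ha : w A < w B)
    (hP : Pres w B) (hc : C0 w) : C0 (w * swap A B) := by
  refine ⟨fun p q r ht => ?_, bridge_F4_all h ha hP hc.2⟩
  have := T3_down h ht (bridge_T3 h hP ht)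
  rw [mul_swap_swap] at this
  exact hc.1 _ _ _ this

lemma bridge_C1 {w : Perm (Fin n)} {A B : Fin n} (h : (B : ℕ) = A + 1) (ha : w A < w B)
    (hP : Pres w B) (hc : C1 w) : C1 (w * swap A B) := by
  refine ⟨?_, bridge_F4_all h ha hP hc.2⟩
  obtain ⟨⟨p, q, r, hT, hu⟩, _⟩ := hc
  refine ⟨_, _, _, T3_up h ha hT, ?_⟩
  intro p' q' r' ht
  have := T3_down h ht (bridge_T3 h hP ht)
  rw [mul_swap_swap] at this
  obtain ⟨rfl, rfl, rfl⟩ := hu _ _ _ this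
  simp

open Classical in
/-- the lower interval -/
noncomputable def LI (w : Perm (Fin n)) : Finset (Perm (Fin n)) := univ.filter fun u => BD u w

lemma mem_LI {u w : Perm (Fin n)} : u ∈ LI w ↔ BD u w := by
  classical
  simp [LI]

lemma LI_mul {w : Perm (Fin n)} {A B : Fin n} (h : (B : ℕ) = A + 1) (ha : w A < w B) :
    LI (w * swap A B) = LI w ∪ (LI w).image (· * swap A B) := by
  ext u
  rw [mem_LI, BD_mul_iff h ha, mem_union, mem_LI, mem_image]
  apply or_congr Iff.rfl
  constructor
  · intro hu; exact ⟨_, mem_LI.2 hu, mul_swap_swap u A B⟩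
  · rintro ⟨v, hv, rfl⟩
    rw [mul_swap_swap]; exact mem_LI.1 hv

lemma mul_swap_inj (A B : Fin n) : Function.Injective (fun u : Perm (Fin n) => u * swap A B) :=
  mul_left_injective _

lemma bridge_disj {w : Perm (Fin n)} {A B : Fin n} (h : (B : ℕ) = A + 1)
    (hP : Pres w B) : Disjoint (LI w) ((LI w).image (· * swap A B)) := by
  rw [disjoint_left]
  intro u hu hu'
  obtain ⟨v, hv, rfl⟩ := mem_image.1 hu'
  have hv' := BD_Pres (mem_LI.1 hv) B.2.le hP
  have : v A < v B := by
    have := hv' A (by omega)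
    have := Pres_ge hv' B le_rfl
    rw [Fin.lt_def]; omega
  exact not_Pres_mul v h this (BD_Pres (mem_LI.1 hu) B.2.le hP)

lemma bridge_card {w : Perm (Fin n)} {A B : Fin n} (h : (B : ℕ) = A + 1) (ha : w A < w B)
    (hP : Pres w B) : (LI (w * swap A B)).card = 2 * (LI w).card := by
  rw [LI_mul h ha, card_union_of_disjoint (bridge_disj h hP),
    card_image_of_injective _ (mul_swap_inj A B)]
  omega

lemma Jset_notMem_of_Pres {w : Perm (Fin n)} {B : Fin n} : Pres w B ↔ (B:ℕ) ∉ Jset w := by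
  rw [mem_Jset]; have := B.2; tauto

lemma LI_one : LI (1 : Perm (Fin n)) = {1} := by
  ext u
  rw [mem_LI, mem_singleton]
  constructor
  · intro hu
    have h1 := Jset_mono hu
    rw [Jset_one, subset_empty] at h1
    by_contra hne
    obtain ⟨A, B, w', h, ha, rfl⟩ := exists_desc_factor u hne
    rw [Jset_mul w' h ha] at h1
    exact insert_ne_empty _ _ h1
  · rintro rfl; exact BD_refl _

theorem Z0 (w : Perm (Fin n)) (hw : (Jset w).card = invN w) :
    C0 w ∧ Set.InjOn Jset (LI w : Set (Perm (Fin n))) ∧ (LI w).card = 2 ^ invN w := by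
  induction w using perm_ind with
  | h1 =>
    refine ⟨⟨?_, ?_⟩, ?_, ?_⟩
    · rintro p q r ⟨h1, h2, h3, h4⟩; simp at h3 h4; grind
    · rintro p q r t ⟨h1, h2, h3, h4, h5, h6⟩; simp at h4 h5 h6; grind
    · rw [LI_one]; simp
    · rw [LI_one, invN_one]; simp
  | hs w A B h ha ih =>
    have hle := card_Jset_le w
    rw [Jset_mul w h ha, invN_mul_swap w h ha] at hw
    have hB : (B:ℕ) ∉ Jset w := by
      intro hB; rw [insert_eq_of_mem hB] at hw; omega
    rw [card_insert_of_notMem hB] at hw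
    obtain ⟨i1, i2, i3⟩ := ih (by omega)
    have hP := Jset_notMem_of_Pres.2 hB
    refine ⟨bridge_C0 h ha hP i1, ?_, ?_⟩
    · have asc : ∀ v ∈ LI w, v A < v B := by
        intro v hv
        have hv' := BD_Pres (mem_LI.1 hv) B.2.le hP
        have := hv' A (by omega)
        have := Pres_ge hv' B le_rfl
        rw [Fin.lt_def]; omega
      have nB : ∀ v ∈ LI w, (B:ℕ) ∉ Jset v := fun v hv =>
        Jset_notMem_of_Pres.1 (BD_Pres (mem_LI.1 hv) B.2.le hP)
      intro u hu v hv huv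
      rw [mem_coe, LI_mul h ha, mem_union, mem_image] at hu hv
      rcases hu with hu | ⟨u', hu, rfl⟩ <;> rcases hv with hv | ⟨v', hv, rfl⟩
      · exact i2 hu hv huv
      · exfalso
        rw [Jset_mul v' h (asc v' hv)] at huv
        exact nB u hu (huv ▸ mem_insert_self _ _)
      · exfalso
        rw [Jset_mul u' h (asc u' hu)] at huv
        exact nB v hv (huv ▸ mem_insert_self _ _)
      · rw [Jset_mul u' h (asc u' hu), Jset_mul v' h (asc v' hv)] at huv
        have := i2 hu hv (by
          rw [← erase_insert (nB u' hu), huv, erase_insert (nB v' hv)])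
        rw [this]
    · rw [bridge_card h ha hP, i3, invN_mul_swap w h ha, pow_succ]; ring


lemma card_val_lt (x : Perm (Fin n)) (m : ℕ) (hm : m ≤ n) :
    (univ.filter fun z : Fin n => (x z : ℕ) < m).card = m := by
  have : (univ.filter fun z : Fin n => (x z : ℕ) < m) =
    (univ.filter fun z : Fin n => (z : ℕ) < m).image (⇑(x⁻¹)) := by
    ext z
    rw [mem_filter, mem_image]
    constructor
    · rintro ⟨_, hz⟩
      exact ⟨x z, by rw [mem_filter]; exact ⟨mem_univ _, hz⟩, by simp⟩
    · rintro ⟨y, hy, rfl⟩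
      rw [mem_filter] at hy
      exact ⟨mem_univ _, by simpa using hy.2⟩
  rw [this, card_image_of_injective _ (x⁻¹).injective, Fin.card_filter_val_lt]
  omega

lemma F4_count {w : Perm (Fin n)} {A B : Fin n} (h : (B : ℕ) = A + 1) (ha : w A < w B)
    (hJ : (Jset w).card = invN w) (hT : ∀ p q r, ¬ T3 (w * swap A B) p q r)
    {p t : Fin n} (hF : F4 (w * swap A B) p A B t) :
    3 * 2 ^ invN (w * swap A B) < 4 * (LI (w * swap A B)).card := by
  obtain ⟨z1, z2, z3⟩ := Z0 w hJ
  obtain ⟨h1, h2, h3, h4, h5, h6⟩ := id hF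
  rw [mul_swap_A, mul_swap_ne w (by grind) (by grind)] at h6
  rw [mul_swap_ne w (by grind) (by grind), mul_swap_ne w (by grind) (by grind)] at h5
  rw [mul_swap_B, mul_swap_ne w (by grind) (by grind)] at h4
  have T : ∀ p q r, p ≠ A → p ≠ B → q ≠ A → q ≠ B → r ≠ A → r ≠ B → ¬ T3 w p q r := by
    intro p q r e1 e2 e3 e4 e5 e6 h
    exact z1.1 _ _ _ h
  have lo : ∀ z, z < A → z ≠ p → w z < w t := by
    intro z hz hne
    by_contra hcon
    have hn1 : w z ≠ w t := fun hh => by have := w.injective hh; grind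
    have hn2 : w z ≠ w p := fun hh => by have := w.injective hh; grind
    have hn3 : w z ≠ w B := fun hh => by have := w.injective hh; grind
    have t1 := hT z A B
    unfold T3 at t1
    rw [mul_swap_A, mul_swap_B, mul_swap_ne w (by grind) (by grind)] at t1
    have t2 := z1.1 z p t
    have t3 := z1.1 p z t
    have t4 := z1.2 z p A t
    have t5 := z1.2 p z A t
    unfold T3 at t2 t3
    unfold F4 at t4 t5
    grind
  have hi : ∀ z, B < z → z ≠ t → w p < w z := by
    intro z hz hne
    by_contra hcon
    have hn1 : w z ≠ w t := fun hh => by have := w.injective hh; grind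
    have hn2 : w z ≠ w p := fun hh => by have := w.injective hh; grind
    have hn3 : w z ≠ w A := fun hh => by have := w.injective hh; grind
    have t1 := hT A B z
    unfold T3 at t1
    rw [mul_swap_A, mul_swap_B, mul_swap_ne w (by grind) (by grind)] at t1
    have t2 := z1.1 p z t
    have t3 := z1.1 p t z
    have t4 := z1.2 p B z t
    have t5 := z1.2 p B t z
    unfold T3 at t2 t3
    unfold F4 at t4 t5
    grind
  have hu : (w t : ℕ) = A := by
    have e1 := card_val_lt w (w t) (w t).2.le
    have e2 : (univ.filter fun z : Fin n => (w z : ℕ) < (w t : ℕ)) =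
        (univ.filter fun z : Fin n => (z : ℕ) < B).erase p := by
      ext z
      rw [mem_filter, mem_erase, mem_filter, ← Fin.lt_def, ← Fin.lt_def]
      rcases eq_or_ne z p with e | e
      · grind
      rcases eq_or_ne z t with e | e
      · grind
      rcases eq_or_ne z A with e | e
      · grind
      rcases eq_or_ne z B with e | e
      · grind
      have := lo z
      have := hi z
      grind
    rw [e2, card_erase_of_mem (by rw [mem_filter]; exact ⟨mem_univ _, by grind⟩),
      Fin.card_filter_val_lt] at e1
    omega
  have hV : (w p : ℕ) = B := by
    have e1 := card_val_lt w (w p) (w p).2.le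
    have e2 : (univ.filter fun z : Fin n => (w z : ℕ) < (w p : ℕ)) =
        insert t ((univ.filter fun z : Fin n => (z : ℕ) < B).erase p) := by
      ext z
      rw [mem_filter, mem_insert, mem_erase, mem_filter, ← Fin.lt_def, ← Fin.lt_def]
      rcases eq_or_ne z p with e | e
      · grind
      rcases eq_or_ne z t with e | e
      · grind
      rcases eq_or_ne z A with e | e
      · grind
      rcases eq_or_ne z B with e | e
      · grind
      have := lo z
      have := hi z
      grind
    rw [e2, card_insert_of_notMem (by rw [mem_erase, mem_filter]; grind),
      card_erase_of_mem (by rw [mem_filter]; exact ⟨mem_univ _, by grind⟩),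
      Fin.card_filter_val_lt] at e1
    omega
  have h6' : (w p : ℕ) < w B := h6
  have hBn := (w B).2
  have hpA : (p : ℕ) < A := h1
  have jA : (A:ℕ) ∈ Jset w := by
    rw [mem_Jset]; exact ⟨A.2, fun hh => by have := hh p h1; omega⟩
  have jB : (B:ℕ) ∈ Jset w := by
    rw [mem_Jset]; exact ⟨B.2, fun hh => by have := hh p (by omega); omega⟩
  have jC : (B:ℕ) + 1 ∈ Jset w := by
    rw [mem_Jset]; exact ⟨by omega, fun hh => by have := hh B (by omega); omega⟩
  have r1 : rk w B (B + 1) = B := by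
    apply rk_eq_of w B.2.le
    intro z hz
    rcases eq_or_ne z p with e' | e'
    · subst e'; omega
    rcases eq_or_ne z A with e | e
    · subst e; rw [Fin.lt_def] at h4; omega
    have := lo z (by grind) e'
    rw [Fin.lt_def] at this; omega
  have r2 : (A : ℕ) ≤ rk w B A := by
    unfold rk
    have e2 : (univ.filter fun z : Fin n => (z : ℕ) < B ∧ (w z : ℕ) < A) =
        (univ.filter fun z : Fin n => (z : ℕ) < B).erase p := by
      ext z
      rw [mem_filter, mem_erase, mem_filter, ← hu, ← Fin.lt_def, ← Fin.lt_def]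
      have := lo z
      grind
    rw [e2, card_erase_of_mem (by rw [mem_filter]; exact ⟨mem_univ _, by grind⟩),
      Fin.card_filter_val_lt]
    omega
  classical
  set X := (LI w).filter fun v => v A < v B ∧ v * swap A B ∈ LI w with hX
  have hXJ : ∀ v ∈ X, Jset v ⊆ Jset w \ {(A:ℕ), (B:ℕ), (B:ℕ) + 1} := by
    intro v hv
    rw [hX, mem_filter] at hv
    obtain ⟨v1, v2, v3⟩ := hv
    have b1 := mem_LI.1 v1
    have b2 := mem_LI.1 v3
    have pB : Pres v B := by
      rw [Jset_notMem_of_Pres]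
      intro hB
      have e := Jset_mul v h v2
      rw [insert_eq_of_mem hB] at e
      have := z2 v3 v1 e
      have := congrArg (fun f => f A) this
      simp only [mul_swap_A] at this
      grind
    have vB := Pres_ge pB B le_rfl
    have pA : Pres v A := by
      apply of_rk_eq v A.2.le
      have := b2 B A
      have e1 := rk_succ (v * swap A B) A A
      rw [rk_mul_swap_ne v h A _ (by omega), mul_swap_A, if_neg (by omega), ← h] at e1
      omega
    have pC : Pres v (B+1) := by
      have q1 := b1 B (B+1)
      have q2 := b2 B (B+1)
      rw [r1] at q1 q2
      have q1' := of_rk_eq v B.2.le q1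
      have q2' := of_rk_eq _ B.2.le q2 A (by omega)
      rw [mul_swap_A] at q2'
      intro z hz
      rcases eq_or_ne z B with e | e
      · subst e; exact q2'
      · exact q1' z (by have : (z:ℕ) ≠ B := fun hh => e (Fin.ext hh); omega)
    intro i hi
    rw [mem_sdiff]
    refine ⟨Jset_mono b1 hi, ?_⟩
    rw [mem_insert, mem_insert, mem_singleton]
    rw [mem_Jset] at hi
    rintro (rfl | rfl | rfl) <;> tauto
  have hXc : X.card ≤ 2 ^ (invN w - 3) := by
    have c1 : X.card ≤ (Jset w \ {(A:ℕ), (B:ℕ), (B:ℕ) + 1}).powerset.card := by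
      apply card_le_card_of_injOn Jset
      · intro v hv; rw [mem_coe, mem_powerset]; exact hXJ v hv
      · exact z2.mono (by intro v hv; exact (mem_filter.1 hv).1)
    rw [card_powerset, card_sdiff_of_subset (by
      intro i; rw [mem_insert, mem_insert, mem_singleton]; rintro (rfl | rfl | rfl) <;> assumption)] at c1
    have : ({(A:ℕ), (B:ℕ), (B:ℕ) + 1} : Finset ℕ).card = 3 := by
      rw [card_eq_three]; exact ⟨_, _, _, by omega, by omega, by omega, rfl⟩
    rwa [this, hJ] at c1
  have h3le : 3 ≤ invN w := by
    have : ({(A:ℕ), (B:ℕ), (B:ℕ) + 1} : Finset ℕ).card = 3 := by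
      rw [card_eq_three]; exact ⟨_, _, _, by omega, by omega, by omega, rfl⟩
    rw [← hJ, ← this]
    apply card_le_card
    intro i; rw [mem_insert, mem_insert, mem_singleton]; rintro (rfl | rfl | rfl) <;> assumption
  have hU : 2 * (LI w).card ≤ (LI (w * swap A B)).card + 2 * X.card := by
    have c1 := card_union_add_card_inter (LI w) ((LI w).image (· * swap A B))
    rw [← LI_mul h ha, card_image_of_injective _ (mul_swap_inj A B)] at c1
    have c2 : ((LI w) ∩ ((LI w).image (· * swap A B))).card ≤ (X ∪ X.image (· * swap A B)).card := by
      apply card_le_card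
      intro u hu
      rw [mem_inter, mem_image] at hu
      obtain ⟨hu1, v, hv, rfl⟩ := hu
      rw [mem_union]
      rcases asc_or_desc v h with hd | hd
      · right; exact mem_image.2 ⟨v, by rw [hX, mem_filter]; exact ⟨hv, hd, hu1⟩, rfl⟩
      · left; rw [hX, mem_filter]
        exact ⟨hu1, by rw [mul_swap_A, mul_swap_B]; exact hd, by rw [mul_swap_swap]; exact hv⟩
    have c3 := card_union_le X (X.image (· * swap A B))
    rw [card_image_of_injective _ (mul_swap_inj A B)] at c3
    omega
  rw [z3] at hU
  rw [invN_mul_swap w h ha]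
  obtain ⟨k, hk⟩ : ∃ k, invN w = k + 3 := ⟨invN w - 3, by omega⟩
  rw [hk] at hU hXc ⊢
  have : k + 3 - 3 = k := by omega
  rw [this] at hXc
  have hpos : 0 < 2 ^ k := by positivity
  have e1 : 2 ^ (k+3) = 8 * 2 ^ k := by ring
  have e2 : 2 ^ (k+3+1) = 16 * 2 ^ k := by ring
  omega

theorem C1_of_count (w : Perm (Fin n)) (hJ : (Jset w).card + 1 = invN w)
    (hN : 4 * (LI w).card = 3 * 2 ^ invN w) : C1 w := by
  induction hm : invN w using Nat.strong_induction_on generalizing w with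
  | _ m ih =>
  by_cases hb : ∃ (A B : Fin n) (w' : Perm (Fin n)), (B:ℕ) = A + 1 ∧ w' A < w' B ∧ w = w' * swap A B ∧ Pres w' B
  · obtain ⟨A, B, w', h, ha, rfl, hP⟩ := hb
    rw [invN_mul_swap w' h ha] at hJ hN hm
    rw [Jset_mul w' h ha, card_insert_of_notMem (Jset_notMem_of_Pres.1 hP)] at hJ
    rw [bridge_card h ha hP, pow_succ] at hN
    exact bridge_C1 h ha hP (ih (invN w') (by omega) w' (by omega) (by omega) rfl)
  · push Not at hb
    have key : ∀ A B : Fin n, (B:ℕ) = A + 1 → w B < w A →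
        (Jset (w * swap A B)).card = invN (w * swap A B) ∧ ¬ Pres (w * swap A B) B := by
      intro A B h hd
      have hnp := hb A B (w * swap A B) h (by simpa using hd) (mul_swap_swap _ _ _).symm
      refine ⟨?_, hnp⟩
      have e1 := Jset_mul (w * swap A B) h (by simpa using hd)
      have e2 := invN_mul_swap (w * swap A B) h (by simpa using hd)
      rw [mul_swap_swap] at e1 e2
      rw [Jset_notMem_of_Pres, not_not] at hnp
      rw [insert_eq_of_mem hnp] at e1
      rw [← e1]; omega
    have kT : ∀ A B : Fin n, (B:ℕ) = A + 1 → w B < w A → ∀ p q r, T3 w p q r →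
        ((p = A ∧ q = B) ∨ (q = A ∧ r = B)) := by
      intro A B h hd p q r ht
      by_contra hcon
      exact (Z0 _ (key A B h hd).1).1.1 _ _ _ (T3_down h ht hcon)
    have kF : ∀ A B : Fin n, (B:ℕ) = A + 1 → w B < w A → ∀ p q r t, F4 w p q r t →
        (q = A ∧ r = B) := by
      intro A B h hd p q r t ht
      by_contra hcon
      exact (Z0 _ (key A B h hd).1).1.2 _ _ _ _ (F4_down h hd ht hcon)
    by_cases hT : ∃ p q r, T3 w p q r
    · obtain ⟨p, q, r, ht⟩ := hT
      obtain ⟨h1, h2, h3, h4⟩ := id ht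
      have d1 : (q:ℕ) = p + 1 ∧ w q < w p := by
        obtain ⟨A, B, h, hd, i1, i2⟩ := exists_desc_between w h1 h3
        have := kT A B h hd _ _ _ ht
        grind
      have d2 : (r:ℕ) = q + 1 ∧ w r < w q := by
        obtain ⟨A, B, h, hd, i1, i2⟩ := exists_desc_between w h2 h4
        have := kT A B h hd _ _ _ ht
        grind
      refine ⟨⟨p, q, r, ht, ?_⟩, ?_⟩
      · intro p' q' r' ht'
        have e1 := kT p q d1.1 d1.2 _ _ _ ht'
        have e2 := kT q r d2.1 d2.2 _ _ _ ht'
        grind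
      · intro a b c d hf
        have e1 := kF p q d1.1 d1.2 _ _ _ _ hf
        have e2 := kF q r d2.1 d2.2 _ _ _ _ hf
        grind
    · exfalso
      push Not at hT
      have hw : w ≠ 1 := by rintro rfl; rw [invN_one] at hJ; omega
      obtain ⟨A, B, h, hd⟩ := exists_desc w hw
      obtain ⟨k1, k2⟩ := key A B h hd
      rcases descent_lemma w h hd k2 with ⟨d, h1 | h1⟩ | ⟨p, t, hf⟩
      · exact hT _ _ _ h1
      · exact hT _ _ _ h1
      · have := F4_count (w := w * swap A B) h (by simpa using hd) k1
          (by rw [mul_swap_swap]; exact hT) (p := p) (t := t) (by rw [mul_swap_swap]; exact hf)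
        rw [mul_swap_swap] at this
        omega

theorem pattern_iff (w : Perm (Fin n)) :
    (ContainsPatternOnce w pattern321 ∧ AvoidsPattern w pattern3412) ↔ C1 w := by
  have o3 : ∀ j : Fin 3 → Fin n, IsPatternOcc w pattern321 j ↔ T3 w (j 0) (j 1) (j 2) := by
    intro j
    have p0 : pattern321 0 = 2 := by decide
    have p1 : pattern321 1 = 1 := by decide
    have p2 : pattern321 2 = 0 := by decide
    unfold IsPatternOcc T3
    constructor
    · rintro ⟨hm, hj⟩
      exact ⟨hm (by decide), hm (by decide), (hj 1 0).2 (by decide), (hj 2 1).2 (by decide)⟩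
    · rintro ⟨h1, h2, h3, h4⟩
      constructor
      · intro a b hab
        fin_cases a <;> fin_cases b <;> simp at hab ⊢ <;> first | assumption | exact h1.trans h2
      · intro a b
        fin_cases a <;> fin_cases b <;> simp [p0, p1, p2] <;>
          first | assumption | exact h4.trans h3 | exact h3.le | exact h4.le | exact (h4.trans h3).le
  have o4 : ∀ j : Fin 4 → Fin n, IsPatternOcc w pattern3412 j ↔ F4 w (j 0) (j 1) (j 2) (j 3) := by
    intro j
    have p0 : pattern3412 0 = 2 := by decide
    have p1 : pattern3412 1 = 3 := by decide
    have p2 : pattern3412 2 = 0 := by decide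
    have p3 : pattern3412 3 = 1 := by decide
    unfold IsPatternOcc F4
    constructor
    · rintro ⟨hm, hj⟩
      exact ⟨hm (by decide), hm (by decide), hm (by decide), (hj 2 3).2 (by decide),
        (hj 3 0).2 (by decide), (hj 0 1).2 (by decide)⟩
    · rintro ⟨h1, h2, h3, h4, h5, h6⟩
      constructor
      · intro a b hab
        fin_cases a <;> fin_cases b <;> simp at hab ⊢ <;> grind
      · intro a b
        fin_cases a <;> fin_cases b <;> simp [p0, p1, p2, p3] <;> grind
  unfold C1 ContainsPatternOnce AvoidsPattern ContainsPattern
  apply and_congr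
  · constructor
    · rintro ⟨j, hj, hu⟩
      refine ⟨j 0, j 1, j 2, (o3 j).1 hj, ?_⟩
      intro p q r ht
      have := hu ![p, q, r] ((o3 _).2 ht)
      rw [← this]; exact ⟨rfl, rfl, rfl⟩
    · rintro ⟨p, q, r, ht, hu⟩
      refine ⟨![p, q, r], (o3 _).2 ht, ?_⟩
      intro j hj
      obtain ⟨e1, e2, e3⟩ := hu _ _ _ ((o3 j).1 hj)
      ext k
      fin_cases k <;> simp [e1, e2, e3]
  · constructor
    · intro h p q r t ht
      exact h ⟨![p, q, r, t], (o4 _).2 ht⟩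
    · rintro h ⟨j, hj⟩
      exact h _ _ _ _ ((o4 j).1 hj)

end CombPart3


section FibPart

variable {E F : Type*} [AddCommGroup E] [Module ℝ E] [AddCommGroup F] [Module ℝ F]

/-- affine functions -/
def IsAff (f : E → F) : Prop :=
  ∀ x y : E, ∀ a b : ℝ, a + b = 1 → f (a • x + b • y) = a • f x + b • f y

lemma IsAff.lin {f : E → F} (hf : IsAff f) : ∃ l : E →ₗ[ℝ] F, ∀ x, f x = l x + f 0 := by
  have hom : ∀ (a : ℝ) (x : E), f (a • x) - f 0 = a • (f x - f 0) := by
    intro a x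
    have := hf x 0 a (1 - a) (by ring)
    rw [smul_zero, add_zero] at this
    rw [this]; module
  refine ⟨⟨⟨fun x => f x - f 0, ?_⟩, ?_⟩, ?_⟩
  · intro x y
    have h1 := hf x y (1/2) (1/2) (by norm_num)
    have h2 := hom 2 ((1/2 : ℝ) • x + (1/2 : ℝ) • y)
    rw [h1] at h2
    have : (2:ℝ) • ((1/2 : ℝ) • x + (1/2 : ℝ) • y) = x + y := by module
    rw [this] at h2
    rw [h2]; module
  · intro a x; exact hom a x
  · intro x; simp

lemma IsAff.sum {f : E → F} (hf : IsAff f) {M : Type*} [Fintype M] (c : M → ℝ) (hc : ∑ m, c m = 1)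
    (x : M → E) : f (∑ m, c m • x m) = ∑ m, c m • f (x m) := by
  obtain ⟨l, hl⟩ := hf.lin
  have h2 : ∑ m, c m • f (x m) = ∑ m, (c m • l (x m) + c m • f 0) :=
    Finset.sum_congr rfl fun m _ => by rw [hl (x m), smul_add]
  rw [h2, Finset.sum_add_distrib, ← Finset.sum_smul, hc, one_smul, hl, map_sum]
  simp only [map_smul]

lemma IsAff.dir {f : E → F} (hf : IsAff f) (z y y' : E) (e : ℝ) :
    f (z + e • (y - y')) = f z + e • (f y - f y') := by
  obtain ⟨l, hl⟩ := hf.lin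
  rw [hl, hl z, hl y, hl y', map_add, map_smul, map_sub]
  module

/-- nonempty faces -/
abbrev NF (P : Set E) := {A : Set E // IsFaceOf P A ∧ A.Nonempty}

lemma face_empty (P : Set E) : IsFaceOf P ∅ := by
  refine ⟨⟨Set.empty_subset _, ?_⟩, convex_empty⟩
  intro x _ y _ z hz; exact hz.elim

lemma face_self {P : Set E} (hP : Convex ℝ P) : IsFaceOf P P := ⟨IsExtreme.refl ℝ P, hP⟩

open Classical in
/-- faces are nonempty faces plus a bottom -/
noncomputable def faceBot (P : Set E) : {A : Set E // IsFaceOf P A} ≃o WithBot (NF P) where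
  toFun A := if h : A.1.Nonempty then ((⟨A.1, A.2, h⟩ : NF P) : WithBot (NF P)) else ⊥
  invFun B := match B with
    | ⊥ => ⟨∅, face_empty P⟩
    | (B : NF P) => ⟨B.1, B.2.1⟩
  left_inv A := by
    by_cases h : A.1.Nonempty
    · simp [h]
    · simp only [h, dite_false]
      apply Subtype.ext
      exact (Set.not_nonempty_iff_eq_empty.1 h).symm
  right_inv B := by
    induction B with
    | bot => simp
    | coe B => simp [B.2.2]
  map_rel_iff' := by
    intro A B
    by_cases h : A.1.Nonempty
    · by_cases h' : B.1.Nonempty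
      · simp only [Equiv.coe_fn_mk, h, h', dite_true, WithBot.coe_le_coe]; rfl
      · simp only [Equiv.coe_fn_mk, h, h', dite_true, dite_false]
        constructor
        · intro hh; simp at hh
        · intro hh; exact absurd (h.mono hh) h'
    · simp only [Equiv.coe_fn_mk, h, dite_false, bot_le, true_iff]
      rw [Set.not_nonempty_iff_eq_empty] at h
      rw [← Subtype.coe_le_coe, h]; exact bot_le

lemma CombEquiv_of_NF {P : Set E} {Q : Set F} (e : NF P ≃o NF Q) : CombEquiv P Q := by
  refine ⟨((faceBot P).trans (e.withBotCongr.trans (faceBot Q).symm)).toEquiv, ?_⟩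
  intro A B
  exact (((faceBot P).trans (e.withBotCongr.trans (faceBot Q).symm)).le_iff_le (x := A) (y := B)).symm

lemma NF_of_CombEquiv {P : Set E} {Q : Set F} (h : CombEquiv P Q) : Nonempty (NF P ≃o NF Q) := by
  obtain ⟨e, he⟩ := h
  have hemp : ∀ A, (e A).1 = ∅ ↔ A.1 = ∅ := by
    intro A
    constructor
    · intro h
      have := (he A ⟨∅, face_empty P⟩).2 (by rw [h]; exact Set.empty_subset _)
      exact Set.subset_empty_iff.1 this
    · intro h
      have := (he A (e.symm ⟨∅, face_empty Q⟩)).1 (by rw [h]; exact Set.empty_subset _)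
      rw [Equiv.apply_symm_apply] at this
      exact Set.subset_empty_iff.1 this
  have hne : ∀ A, (e A).1.Nonempty ↔ A.1.Nonempty := by
    intro A; rw [Set.nonempty_iff_ne_empty, Set.nonempty_iff_ne_empty, Ne, Ne, hemp]
  refine ⟨⟨⟨fun A => ⟨(e ⟨A.1, A.2.1⟩).1, (e ⟨A.1, A.2.1⟩).2, (hne _).2 A.2.2⟩,
    fun B => ⟨(e.symm ⟨B.1, B.2.1⟩).1, (e.symm ⟨B.1, B.2.1⟩).2, ?_⟩, ?_, ?_⟩, ?_⟩⟩
  · rw [← hne, Equiv.apply_symm_apply]; exact B.2.2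
  · intro A; simp
  · intro A; simp
  · intro A B
    exact (he ⟨A.1, A.2.1⟩ ⟨B.1, B.2.1⟩).symm

/-- fibration with combinatorially constant fibres -/
structure Fib {K M : Type} [Fintype M] (I : K → M → Prop) (Q : Set E) (P : Set F) where
  π : E → F
  hπ : IsAff π
  g : K → E → ℝ
  hg : ∀ k, IsAff (g k)
  L : E → ℝ
  hL : IsAff L
  mem : ∀ x, x ∈ Q ↔ π x ∈ P ∧ L x = 0 ∧ ∀ k, 0 ≤ g k x
  v : M → F → E
  hv : ∀ m p q (a b : ℝ), p ∈ P → q ∈ P → 0 ≤ a → 0 ≤ b → a + b = 1 →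
    v m (a • p + b • q) = a • v m p + b • v m q
  vQ : ∀ m p, p ∈ P → v m p ∈ Q
  πv : ∀ m p, p ∈ P → π (v m p) = p
  gv : ∀ m p k, p ∈ P → (g k (v m p) = 0 ↔ I k m)
  comb : ∀ x ∈ Q, ∃ c : M → ℝ, (∀ m, 0 ≤ c m) ∧ ∑ m, c m = 1 ∧ x = ∑ m, c m • v m (π x)

/-- zero patterns -/
def Zs {K M : Type} (I : K → M → Prop) : Set (Set K) :=
  {Z | ∃ S : Set M, S.Nonempty ∧ Z = {k | ∀ m ∈ S, I k m}}

variable {K M : Type} [Fintype M] {I : K → M → Prop} {Q : Set E} {P : Set F}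

lemma Fib.convex (f : Fib I Q P) (hP : Convex ℝ P) : Convex ℝ Q := by
  intro x hx y hy a b ha hb hab
  rw [f.mem] at *
  rw [f.hπ _ _ _ _ hab, f.hL _ _ _ _ hab]
  refine ⟨hP hx.1 hy.1 ha hb hab, by simp [hx.2.1, hy.2.1], fun k => ?_⟩
  rw [f.hg k _ _ _ _ hab]
  have := hx.2.2 k
  have := hy.2.2 k
  simp only [smul_eq_mul]
  positivity

lemma Fib.section (f : Fib I Q P) (hP : Convex ℝ P) {p : F} (hp : p ∈ P) (c : M → ℝ) (h0 : ∀ m, 0 ≤ c m)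
    (h1 : ∑ m, c m = 1) :
    (∑ m, c m • f.v m p) ∈ Q ∧ f.π (∑ m, c m • f.v m p) = p ∧
      ∀ k, f.g k (∑ m, c m • f.v m p) = 0 ↔ ∀ m, 0 < c m → I k m := by
  have hQ : (∑ m, c m • f.v m p) ∈ Q :=
    (f.convex hP).sum_mem (fun m _ => h0 m) h1 (fun m _ => f.vQ m p hp)
  refine ⟨hQ, ?_, ?_⟩
  · rw [f.hπ.sum c h1]
    simp only [f.πv _ p hp]
    rw [← Finset.sum_smul, h1, one_smul]
  · intro k
    rw [(f.hg k).sum c h1]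
    simp only [smul_eq_mul]
    have hnn : ∀ m, 0 ≤ f.g k (f.v m p) := fun m => ((f.mem _).1 (f.vQ m p hp)).2.2 k
    rw [Finset.sum_eq_zero_iff_of_nonneg (fun m _ => mul_nonneg (h0 m) (hnn m))]
    constructor
    · intro h m hm
      have := h m (Finset.mem_univ _)
      rw [mul_eq_zero] at this
      exact (f.gv m p k hp).1 (this.resolve_left hm.ne')
    · intro h m _
      rcases (h0 m).eq_or_lt with h2 | h2
      · rw [← h2, zero_mul]
      · rw [(f.gv m p k hp).2 (h m h2), mul_zero]

lemma Fib.generic [Finite K] (f : Fib I Q P) {G : Set E} (hGQ : G ⊆ Q) (hG : Convex ℝ G) (hne : G.Nonempty) :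
    ∃ x ∈ G, ∀ k, f.g k x = 0 → ∀ y ∈ G, f.g k y = 0 := by
  classical
  cases nonempty_fintype K
  have : ∀ s : Finset K, ∃ x ∈ G, ∀ k ∈ s, f.g k x = 0 → ∀ y ∈ G, f.g k y = 0 := by
    intro s
    induction s using Finset.induction_on with
    | empty => obtain ⟨x, hx⟩ := hne; exact ⟨x, hx, by simp⟩
    | insert k s _ ih =>
      obtain ⟨x, hx, h⟩ := ih
      by_cases hk : ∀ y ∈ G, f.g k y = 0
      · refine ⟨x, hx, fun k' hk' h0 => ?_⟩
        rcases Finset.mem_insert.1 hk' with rfl | h'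
        · exact hk
        · exact h k' h' h0
      · push Not at hk
        obtain ⟨y, hy, hy0⟩ := hk
        have hh : (1/2:ℝ) + 1/2 = 1 := by norm_num
        refine ⟨(1/2:ℝ) • x + (1/2:ℝ) • y, hG hx hy (by norm_num) (by norm_num) hh,
          fun k' hk' h0 => ?_⟩
        rw [f.hg k' _ _ _ _ hh] at h0
        have n1 := ((f.mem _).1 (hGQ hx)).2.2 k'
        have n2 := ((f.mem _).1 (hGQ hy)).2.2 k'
        simp only [smul_eq_mul] at h0
        rcases Finset.mem_insert.1 hk' with rfl | h'
        · exact absurd (by linarith) hy0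
        · exact h k' h' (by linarith)
  obtain ⟨x, hx, h⟩ := this Finset.univ
  exact ⟨x, hx, fun k => h k (Finset.mem_univ _)⟩

lemma Fib.eps [Finite K] (f : Fib I Q P) {z y y' : E} (hz : z ∈ Q) (hy : y ∈ Q) (hy' : y' ∈ Q)
    (hπ : f.π y = f.π y') (h0 : ∀ k, f.g k z = 0 → f.g k y = 0 ∧ f.g k y' = 0) :
    ∃ e : ℝ, 0 < e ∧ e < 1/2 ∧ z + e • (y - y') ∈ Q := by
  classical
  cases nonempty_fintype K
  have : ∀ s : Finset K, ∃ d : ℝ, 0 < d ∧ d < 1/2 ∧ ∀ e, 0 < e → e ≤ d → ∀ k ∈ s,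
      0 ≤ f.g k (z + e • (y - y')) := by
    intro s
    induction s using Finset.induction_on with
    | empty => exact ⟨1/4, by norm_num, by norm_num, by simp⟩
    | insert k s _ ih =>
      obtain ⟨d, d0, d1, hd⟩ := ih
      have nz := ((f.mem _).1 hz).2.2 k
      rcases nz.eq_or_lt with hk | hk
      · refine ⟨d, d0, d1, fun e e0 e1 k' hk' => ?_⟩
        rcases Finset.mem_insert.1 hk' with rfl | h'
        · have := h0 k' hk.symm
          rw [(f.hg k').dir, this.1, this.2, ← hk]; simp
        · exact hd e e0 e1 k' h'
      · set r := |f.g k y - f.g k y'| + 1 with hr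
        have hrpos : 0 < r := by positivity
        refine ⟨min d (f.g k z / r), by positivity, (min_le_left _ _).trans_lt d1,
          fun e e0 e1 k' hk' => ?_⟩
        rcases Finset.mem_insert.1 hk' with rfl | h'
        · rw [(f.hg k').dir, smul_eq_mul]
          have h1 : e ≤ f.g k' z / r := e1.trans (min_le_right _ _)
          rw [le_div_iff₀ hrpos] at h1
          have h2 := neg_abs_le (f.g k' y - f.g k' y')
          nlinarith
        · exact hd e e0 (e1.trans (min_le_left _ _)) k' h'
  obtain ⟨d, d0, d1, hd⟩ := this Finset.univ
  refine ⟨d, d0, d1, ?_⟩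
  rw [f.mem, f.hπ.dir, f.hL.dir, hπ, ((f.mem _).1 hz).2.1, ((f.mem _).1 hy).2.1, ((f.mem _).1 hy').2.1]
  exact ⟨by simpa using ((f.mem _).1 hz).1, by simp, fun k => hd d d0 le_rfl k (Finset.mem_univ _)⟩

lemma Fib.key [Finite K] (f : Fib I Q P) (hP : Convex ℝ P) {G : Set E} (hG : IsFaceOf Q G) {y : E} (hy : y ∈ Q)
    (hyπ : f.π y ∈ f.π '' G) (hyk : ∀ k, (∀ x ∈ G, f.g k x = 0) → f.g k y = 0) : y ∈ G := by
  have hQ := f.convex hP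
  obtain ⟨hE, hC⟩ := hG
  obtain ⟨y0, hy0, e0⟩ := hyπ
  obtain ⟨x, hx, hxg⟩ := f.generic hE.subset hC ⟨y0, hy0⟩
  have hh : (1/2:ℝ) + 1/2 = 1 := by norm_num
  set z := (1/2:ℝ) • x + (1/2:ℝ) • y0 with hz
  have hzG : z ∈ G := hC hx hy0 (by norm_num) (by norm_num) hh
  obtain ⟨e, e0, e1, he⟩ := f.eps (hE.subset hzG) (hE.subset hy0) hy e0 (by
    intro k hk
    rw [hz, f.hg k _ _ _ _ hh] at hk
    have n1 := ((f.mem _).1 (hE.subset hx)).2.2 k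
    have n2 := ((f.mem _).1 (hE.subset hy0)).2.2 k
    simp only [smul_eq_mul] at hk
    have := hxg k (by linarith)
    exact ⟨this y0 hy0, hyk k this⟩)
  have e2 : 0 < 1 - e := by linarith
  set q := (1/2/(1-e)) • x + ((1/2-e)/(1-e)) • y0 with hq
  have hqG : q ∈ G := hC hx hy0 (by positivity) (div_nonneg (by linarith) e2.le) (by field_simp; ring)
  set r := (1 - e) • q + e • y with hr
  have hrQ : r ∈ Q := hQ (hE.subset hqG) hy e2.le e0.le (by ring)
  have hr' : r = z - e • (y0 - y) := by
    rw [hr, hq, hz, smul_add, smul_smul, smul_smul, mul_div_cancel₀ _ e2.ne', mul_div_cancel₀ _ e2.ne']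
    module
  have hrG : r ∈ G := by
    apply hE.left_mem_of_mem_openSegment hrQ he hzG
    exact ⟨1/2, 1/2, by norm_num, by norm_num, hh, by rw [hr']; module⟩
  exact hE.right_mem_of_mem_openSegment (hE.subset hqG) hy hrG ⟨1-e, e, e2, e0, by ring, rfl⟩

lemma Fib.image_face (f : Fib I Q P) (hP : Convex ℝ P) {G : Set E} (hG : IsFaceOf Q G) :
    IsFaceOf P (f.π '' G) := by
  obtain ⟨hE, hC⟩ := hG
  refine ⟨⟨?_, ?_⟩, ?_⟩
  · rintro _ ⟨x, hx, rfl⟩; exact ((f.mem _).1 (hE.subset hx)).1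
  · rintro p1 hp1 p2 hp2 _ ⟨x, hx, rfl⟩ ⟨a, b, ha, hb, hab, hx'⟩
    obtain ⟨c, c0, c1, hc⟩ := f.comb x (hE.subset hx)
    obtain ⟨q1, q2, -⟩ := f.section hP hp1 c c0 c1
    obtain ⟨r1, r2, -⟩ := f.section hP hp2 c c0 c1
    refine ⟨_, hE.left_mem_of_mem_openSegment q1 r1 hx ⟨a, b, ha, hb, hab, ?_⟩, q2⟩
    rw [hc, ← hx']
    simp only [f.hv _ _ _ a b hp1 hp2 ha.le hb.le hab, Finset.smul_sum, smul_add,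
      Finset.sum_add_distrib]
    congr 1 <;> apply Finset.sum_congr rfl <;> intro m _ <;> rw [smul_comm]
  · rintro _ ⟨x, hx, rfl⟩ _ ⟨y, hy, rfl⟩ a b ha hb hab
    exact ⟨_, hC hx hy ha hb hab, f.hπ _ _ _ _ hab⟩

lemma Fib.face_of (f : Fib I Q P) (hP : Convex ℝ P) {A : Set F} (hA : IsFaceOf P A) (Z : Set K) :
    IsFaceOf Q {y | y ∈ Q ∧ f.π y ∈ A ∧ ∀ k ∈ Z, f.g k y = 0} := by
  refine ⟨⟨fun y hy => hy.1, ?_⟩, ?_⟩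
  · rintro x hx y hy z ⟨hz, hzA, hzk⟩ ⟨a, b, ha, hb, hab, rfl⟩
    refine ⟨hx, ?_, fun k hk => ?_⟩
    · apply hA.1.left_mem_of_mem_openSegment ((f.mem _).1 hx).1 ((f.mem _).1 hy).1 hzA
      exact ⟨a, b, ha, hb, hab, (f.hπ _ _ _ _ hab).symm⟩
    · have := hzk k hk
      rw [f.hg k _ _ _ _ hab] at this
      have n1 := ((f.mem _).1 hx).2.2 k
      have n2 := ((f.mem _).1 hy).2.2 k
      simp only [smul_eq_mul] at this
      have := mul_nonneg ha.le n1
      have := mul_nonneg hb.le n2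
      have : a * f.g k x = 0 := by linarith
      exact (mul_eq_zero.1 this).resolve_left ha.ne'
  · rintro x ⟨hx, hxA, hxk⟩ y ⟨hy, hyA, hyk⟩ a b ha hb hab
    refine ⟨f.convex hP hx hy ha hb hab, ?_, fun k hk => ?_⟩
    · rw [f.hπ _ _ _ _ hab]; exact hA.2 hxA hyA ha hb hab
    · rw [f.hg k _ _ _ _ hab, hxk k hk, hyk k hk]; simp

lemma Fib.exists_pt (f : Fib I Q P) (hP : Convex ℝ P) {Z : Set K} (hZ : Z ∈ Zs I) {p : F} (hp : p ∈ P) :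
    ∃ y ∈ Q, f.π y = p ∧ ∀ k, f.g k y = 0 ↔ k ∈ Z := by
  classical
  obtain ⟨S, ⟨m0, hm0⟩, rfl⟩ := hZ
  set N : ℕ := (Finset.univ.filter fun m => m ∈ S).card with hN
  have hNpos : 0 < (N:ℝ) := by
    rw [Nat.cast_pos, hN, Finset.card_pos]; exact ⟨m0, by simpa using hm0⟩
  obtain ⟨h1, h2, h3⟩ := f.section hP hp (fun m => if m ∈ S then (1:ℝ) / N else 0)
    (by intro m; split_ifs <;> positivity) (by
      rw [← Finset.sum_filter, Finset.sum_const, ← hN, nsmul_eq_mul]; field_simp)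
  refine ⟨_, h1, h2, fun k => ?_⟩
  rw [h3]
  constructor
  · intro h m hm; exact h m (by simp [hm]; exact Nat.cast_pos.1 hNpos)
  · intro h m hm
    apply h m
    by_contra hc
    simp [hc] at hm

/-- zero pattern of a face -/
def Fib.KG (f : Fib I Q P) (G : Set E) : Set K := {k | ∀ x ∈ G, f.g k x = 0}

lemma Fib.KG_mem [Finite K] (f : Fib I Q P) {G : Set E} (hG : IsFaceOf Q G) (hne : G.Nonempty)
    (hP : Convex ℝ P) : f.KG G ∈ Zs I := by
  obtain ⟨x, hx, hxg⟩ := f.generic hG.1.subset hG.2 hne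
  obtain ⟨c, c0, c1, hc⟩ := f.comb x (hG.1.subset hx)
  obtain ⟨h1, h2, h3⟩ := f.section hP ((f.mem _).1 (hG.1.subset hx)).1 c c0 c1
  rw [← hc] at h3
  refine ⟨{m | 0 < c m}, ?_, ?_⟩
  · by_contra hcon
    rw [Set.not_nonempty_iff_eq_empty, Set.eq_empty_iff_forall_notMem] at hcon
    have : ∑ m, c m = 0 := Finset.sum_eq_zero fun m _ => le_antisymm (not_lt.1 (hcon m)) (c0 m)
    linarith
  · ext k
    constructor
    · intro h m hm; exact (h3 k).1 (h x hx) m hm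
    · intro h; exact hxg k ((h3 k).2 h)

/-- nonempty faces of the total space -/
noncomputable def Fib.iso [Finite K] (f : Fib I Q P) (hP : Convex ℝ P) : NF Q ≃o NF P × (Zs I)ᵒᵈ := by
  let φ : NF Q → NF P × (Zs I)ᵒᵈ := fun G =>
    (⟨f.π '' G.1, f.image_face hP G.2.1, G.2.2.image _⟩,
      OrderDual.toDual ⟨f.KG G.1, f.KG_mem G.2.1 G.2.2 hP⟩)
  have hle : ∀ G G' : NF Q, φ G ≤ φ G' ↔ G ≤ G' := by
    intro G G'
    constructor
    · rintro ⟨h1, h2⟩ y hy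
      have h1' : f.π '' G.1 ⊆ f.π '' G'.1 := h1
      have h2' : f.KG G'.1 ⊆ f.KG G.1 := h2
      exact f.key hP G'.2.1 (G.2.1.1.subset hy) (h1' ⟨y, hy, rfl⟩) (fun k hk => h2' hk y hy)
    · intro h
      exact ⟨Set.image_mono h, fun k hk x hx => hk x (h hx)⟩
  have hsurj : Function.Surjective φ := by
    rintro ⟨⟨A, hA, hAne⟩, Z⟩
    obtain ⟨Z, hZ⟩ : ∃ Z', OrderDual.toDual Z' = Z := ⟨OrderDual.ofDual Z, rfl⟩
    subst hZ
    obtain ⟨Z, hZ⟩ := Z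
    have hex : ∀ p ∈ A, ∃ y ∈ {y | y ∈ Q ∧ f.π y ∈ A ∧ ∀ k ∈ Z, f.g k y = 0}, f.π y = p ∧
        ∀ k, f.g k y = 0 ↔ k ∈ Z := by
      intro p hp
      obtain ⟨y, h1, h2, h3⟩ := f.exists_pt hP hZ (hA.1.subset hp)
      exact ⟨y, ⟨h1, by rw [h2]; exact hp, fun k hk => (h3 k).2 hk⟩, h2, h3⟩
    have hne : {y | y ∈ Q ∧ f.π y ∈ A ∧ ∀ k ∈ Z, f.g k y = 0}.Nonempty := by
      obtain ⟨p, hp⟩ := hAne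
      obtain ⟨y, h1, -⟩ := hex p hp
      exact ⟨y, h1⟩
    refine ⟨⟨_, f.face_of hP hA Z, hne⟩, ?_⟩
    refine Prod.ext (Subtype.ext ?_) (congrArg OrderDual.toDual (Subtype.ext ?_))
    · ext p
      constructor
      · rintro ⟨y, hy, rfl⟩; exact hy.2.1
      · intro hp
        obtain ⟨y, h1, h2, -⟩ := hex p hp
        exact ⟨y, h1, h2⟩
    · ext k
      constructor
      · intro h
        obtain ⟨p, hp⟩ := hAne
        obtain ⟨y, h1, h2, h3⟩ := hex p hp
        exact (h3 k).1 (h y h1)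
      · intro h y hy; exact hy.2.2 k h
  exact RelIso.ofSurjective (OrderEmbedding.ofMapLEIff φ hle) hsurj

/-- product of order isos -/
def prodIso {α β γ : Type*} [LE α] [LE β] [LE γ] (e : α ≃o β) : α × γ ≃o β × γ where
  toEquiv := Equiv.prodCongr e.toEquiv (Equiv.refl γ)
  map_rel_iff' := by
    intro a b
    simp [Prod.le_def]

theorem Fib.comb_equiv [Finite K] {E' F' : Type*} [AddCommGroup E'] [Module ℝ E'] [AddCommGroup F'] [Module ℝ F']
    {Q' : Set E'} {P' : Set F'} (f : Fib I Q P) (f' : Fib I Q' P') (hP : Convex ℝ P)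
    (hP' : Convex ℝ P') (h : CombEquiv P P') : CombEquiv Q Q' := by
  obtain ⟨e⟩ := NF_of_CombEquiv h
  exact CombEquiv_of_NF ((f.iso hP).trans ((prodIso e).trans (f'.iso hP').symm))

end FibPart


section ConcreteFib

/-- the cube -/
abbrev cubeS (m : ℕ) : Set (Fin m → ℝ) := {x | ∀ k, x k ∈ Set.Icc (0:ℝ) 1}

lemma cube_convex (m : ℕ) : Convex ℝ (cubeS m) := by
  intro x hx y hy a b ha hb hab k
  have h1 := hx k
  have h2 := hy k
  exact (convex_Icc (0:ℝ) 1) h1 h2 ha hb hab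

/-- product with a fixed factor -/
def prodFib {D E F : Type*} [AddCommGroup D] [Module ℝ D] [AddCommGroup E] [Module ℝ E]
    [AddCommGroup F] [Module ℝ F] {K M : Type} [Fintype M] {I : K → M → Prop} {Q : Set E} {P : Set F}
    (R : Set D) (f : Fib I Q P) : Fib I (R ×ˢ Q) (R ×ˢ P) where
  π x := (x.1, f.π x.2)
  hπ := by
    intro x y a b hab
    ext1
    · rfl
    · exact f.hπ _ _ _ _ hab
  g k x := f.g k x.2
  hg := fun k x y a b hab => f.hg k _ _ _ _ hab
  L x := f.L x.2
  hL := fun x y a b hab => f.hL _ _ _ _ hab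
  mem := by
    intro x
    rw [Set.mem_prod, Set.mem_prod, f.mem]
    tauto
  v m p := (p.1, f.v m p.2)
  hv := by
    intro m p q a b hp hq ha hb hab
    ext1
    · rfl
    · exact f.hv m _ _ _ _ hp.2 hq.2 ha hb hab
  vQ := fun m p hp => ⟨hp.1, f.vQ m _ hp.2⟩
  πv := by
    intro m p hp
    ext1
    · rfl
    · exact f.πv m _ hp.2
  gv := fun m p k hp => f.gv m _ k hp.2
  comb := by
    intro x hx
    obtain ⟨c, c0, c1, hc⟩ := f.comb x.2 hx.2
    refine ⟨c, c0, c1, ?_⟩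
    ext1
    · rw [Prod.fst_sum]
      simp only [Prod.smul_fst]
      rw [← Finset.sum_smul, c1, one_smul]
    · rw [Prod.snd_sum]; exact hc

/-- incidence for the segment -/
abbrev Iseg : Bool → Bool → Prop := fun k m => k = m

/-- the cube over the smaller cube -/
noncomputable def cubeFib (m : ℕ) : Fib Iseg (cubeS (m+1)) (cubeS m) where
  π x := fun k => x k.succ
  hπ := fun x y a b hab => rfl
  g k x := if k then 1 - x 0 else x 0
  hg := by
    intro k x y a b hab
    cases k <;> simp
    linear_combination -hab
  L _ := 0
  hL := by intro x y a b hab; simp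
  mem := by
    intro x
    constructor
    · intro h
      refine ⟨fun k => h k.succ, rfl, fun k => ?_⟩
      cases k
      · simpa using (h 0).1
      · simpa using (h 0).2
    · rintro ⟨h1, _, h2⟩ k
      refine Fin.cases ?_ (fun k => ?_) k
      · exact ⟨by simpa using h2 false, by simpa using h2 true⟩
      · exact h1 k
  v b p := Fin.cons (if b then 1 else 0) p
  hv := by
    intro m p q a b hp hq ha hb hab
    ext k
    refine Fin.cases ?_ (fun k => ?_) k
    · cases m <;> simp [hab]
    · simp
  vQ := by
    intro m p hp k
    refine Fin.cases ?_ (fun k => ?_) k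
    · cases m <;> simp
    · exact hp k
  πv := by intro m p hp; ext k; simp
  gv := by intro m p k hp; cases m <;> cases k <;> simp
  comb := by
    intro x hx
    refine ⟨fun b => if b then x 0 else 1 - x 0, ?_, by simp, ?_⟩
    · intro b; cases b
      · simpa using (hx 0).2
      · simpa using (hx 0).1
    · ext k
      refine Fin.cases ?_ (fun k => ?_) k
      · simp
      · simp; ring

/-- incidence for the hexagon -/
abbrev Ihex : Fin 3 × Bool → Equiv.Perm (Fin 3) → Prop :=
  fun k σ => σ k.1 = if k.2 then 2 else 0

lemma four_weights (c1 c2 c3 c4 : ℝ) (s1 s2 s3 s4 : Equiv.Perm (Fin 3)) (h1 : 0 ≤ c1) (h2 : 0 ≤ c2)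
    (h3 : 0 ≤ c3) (h4 : 0 ≤ c4) (hs : c1 + c2 + c3 + c4 = 1) :
    ∃ c : Equiv.Perm (Fin 3) → ℝ, (∀ σ, 0 ≤ c σ) ∧ ∑ σ, c σ = 1 ∧ ∀ f : Equiv.Perm (Fin 3) → ℝ,
      ∑ σ, c σ * f σ = c1 * f s1 + c2 * f s2 + c3 * f s3 + c4 * f s4 := by
  refine ⟨fun σ => (if σ = s1 then c1 else 0) + (if σ = s2 then c2 else 0) +
    (if σ = s3 then c3 else 0) + (if σ = s4 then c4 else 0), ?_, ?_, ?_⟩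
  · intro σ; dsimp only
    have : ∀ (p : Prop) [Decidable p] (c : ℝ), 0 ≤ c → 0 ≤ if p then c else 0 := by
      intro p _ c hc; split_ifs <;> simp [hc]
    have a1 := this (σ = s1) c1 h1
    have a2 := this (σ = s2) c2 h2
    have a3 := this (σ = s3) c3 h3
    have a4 := this (σ = s4) c4 h4
    positivity
  · simp only [Finset.sum_add_distrib, Finset.sum_ite_eq', Finset.mem_univ, if_true, hs]
  · intro f
    simp only [add_mul, Finset.sum_add_distrib, ite_mul, zero_mul, Finset.sum_ite_eq',
      Finset.mem_univ, if_true]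

lemma hex_weights (a b c : ℝ) (hab : a < b) (hbc : b < c) (x : Fin 3 → ℝ) (hx : ∀ k, a ≤ x k ∧ x k ≤ c)
    (hs : x 0 + x 1 + x 2 = a + b + c) :
    ∃ wt : Equiv.Perm (Fin 3) → ℝ, (∀ σ, 0 ≤ wt σ) ∧ ∑ σ, wt σ = 1 ∧
      ∀ k, x k = ∑ σ, wt σ * (![a, b, c] (σ k)) := by
  have x2 : x 2 = a + b + c - x 0 - x 1 := by linarith
  have h0 := hx 0
  have h1 := hx 1
  have h2 := hx 2
  rw [x2] at h2
  rcases le_total (x 0) b with hb | hb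
  · have d1 : 0 < b - a := by linarith
    have d2 : 0 < c - (a + b - x 0) := by linarith
    obtain ⟨s, hs⟩ : ∃ s, s * (b - a) = x 0 - a := ⟨(x 0 - a)/(b-a), by field_simp⟩
    obtain ⟨r, hr⟩ : ∃ r, r * (c - (a + b - x 0)) = x 1 - (a + b - x 0) :=
      ⟨(x 1 - (a + b - x 0))/(c - (a + b - x 0)), by field_simp⟩
    have s0 : 0 ≤ s := by by_contra hh; nlinarith
    have s1 : s ≤ 1 := by by_contra hh; nlinarith
    have r0 : 0 ≤ r := by by_contra hh; nlinarith
    have r1 : r ≤ 1 := by by_contra hh; nlinarith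
    have s1' : 0 ≤ 1 - s := by linarith
    have r1' : 0 ≤ 1 - r := by linarith
    obtain ⟨wt, w1, w2, w3⟩ := four_weights ((1-s)*(1-r)) (s*(1-r)) ((1-s)*r) (s*r) 1 (Equiv.swap 0 1)
      (Equiv.swap 1 2) (Equiv.swap 0 1 * Equiv.swap 1 2) (by positivity) (by positivity)
      (by positivity) (by positivity) (by ring)
    refine ⟨wt, w1, w2, fun k => ?_⟩
    rw [w3 (fun σ => ![a, b, c] (σ k))]
    have e0 : (Equiv.swap 1 2 : Equiv.Perm (Fin 3)) 0 = 0 := by decide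
    have e1 : (Equiv.swap 0 1 : Equiv.Perm (Fin 3)) 2 = 2 := by decide
    fin_cases k <;> simp [e0, e1]
    · linear_combination -hs
    · linear_combination -hr + (1-r)*hs
    · rw [x2]; linear_combination hr + r*hs
  · have d1 : 0 < c - b := by linarith
    have d2 : 0 < b + c - x 0 - a := by linarith
    obtain ⟨s, hs⟩ : ∃ s, s * (c - b) = x 0 - b := ⟨(x 0 - b)/(c-b), by field_simp⟩
    obtain ⟨r, hr⟩ : ∃ r, r * (b + c - x 0 - a) = x 1 - a :=
      ⟨(x 1 - a)/(b + c - x 0 - a), by field_simp⟩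
    have s0 : 0 ≤ s := by by_contra hh; nlinarith
    have s1 : s ≤ 1 := by by_contra hh; nlinarith
    have r0 : 0 ≤ r := by by_contra hh; nlinarith
    have r1 : r ≤ 1 := by by_contra hh; nlinarith
    have s1' : 0 ≤ 1 - s := by linarith
    have r1' : 0 ≤ 1 - r := by linarith
    obtain ⟨wt, w1, w2, w3⟩ := four_weights ((1-s)*(1-r)) (s*(1-r)) ((1-s)*r) (s*r) (Equiv.swap 0 1)
      (Equiv.swap 1 2 * Equiv.swap 0 1) (Equiv.swap 0 1 * Equiv.swap 1 2) (Equiv.swap 0 2)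
      (by positivity) (by positivity)
      (by positivity) (by positivity) (by ring)
    refine ⟨wt, w1, w2, fun k => ?_⟩
    rw [w3 (fun σ => ![a, b, c] (σ k))]
    have e0 : (Equiv.swap 1 2 : Equiv.Perm (Fin 3)) 0 = 0 := by decide
    have e1 : (Equiv.swap 0 1 : Equiv.Perm (Fin 3)) 2 = 2 := by decide
    have e2 : (Equiv.swap 0 2 : Equiv.Perm (Fin 3)) 1 = 1 := by decide
    fin_cases k <;> simp [e0, e1, e2]
    · linear_combination -hs
    · linear_combination -hr + r * hs
    · rw [x2]; linear_combination hr + (1-r)*hs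

lemma permPoint3 (σ : Equiv.Perm (Fin 3)) (k : Fin 3) : permPoint 3 σ k = ![1, 2, 3] (σ k) := by
  unfold permPoint
  generalize σ k = j
  fin_cases j <;> norm_num

lemma hex_eq : Perm2Hex = {x | (∀ k, 1 ≤ x k ∧ x k ≤ 3) ∧ x 0 + x 1 + x 2 = 6} := by
  apply Set.Subset.antisymm
  · apply convexHull_min
    · rintro _ ⟨σ, rfl⟩
      refine ⟨fun k => ?_, ?_⟩
      · rw [permPoint3]
        generalize σ k = j
        fin_cases j <;> norm_num
      · rw [permPoint3, permPoint3, permPoint3]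
        have := Equiv.sum_comp σ (![1, 2, 3] : Fin 3 → ℝ)
        rw [Fin.sum_univ_three, Fin.sum_univ_three] at this
        rw [this]; simp; norm_num
    · intro x hx y hy a b ha hb hab
      refine ⟨fun k => ?_, ?_⟩
      · exact (convex_Icc (1:ℝ) 3) (hx.1 k) (hy.1 k) ha hb hab
      · have h1 := hx.2
        have h2 := hy.2
        simp only [Pi.add_apply, Pi.smul_apply, smul_eq_mul]
        linear_combination a * h1 + b * h2 + 6 * hab
  · rintro x ⟨h1, h2⟩
    obtain ⟨wt, w1, w2, w3⟩ := hex_weights 1 2 3 (by norm_num) (by norm_num) x h1 (by rw [h2]; norm_num)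
    have : x = ∑ σ, wt σ • permPoint 3 σ := by
      ext k
      rw [w3 k, Finset.sum_apply]
      simp only [Pi.smul_apply, smul_eq_mul, permPoint3]
    rw [this]
    apply (convex_convexHull ℝ _).sum_mem (fun σ _ => w1 σ) w2
    intro σ _
    exact subset_convexHull ℝ _ ⟨σ, rfl⟩

lemma hex_convex : Convex ℝ Perm2Hex := convex_convexHull ℝ _

/-- hexagon times cube over cube -/
noncomputable def hexFib (m : ℕ) : Fib Ihex (Perm2Hex ×ˢ cubeS m) (cubeS m) where
  π x := x.2
  hπ := fun x y a b hab => rfl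
  g k x := if k.2 then 3 - x.1 k.1 else x.1 k.1 - 1
  hg := by
    rintro ⟨k, b⟩ x y a c hab
    cases b <;> simp
    · linear_combination hab
    · linear_combination -3 * hab
  L x := x.1 0 + x.1 1 + x.1 2 - 6
  hL := by
    intro x y a b hab
    simp only [Prod.fst_add, Prod.smul_fst, Pi.add_apply, Pi.smul_apply, smul_eq_mul]
    linear_combination 6 * hab
  mem := by
    intro x
    rw [Set.mem_prod, hex_eq]
    constructor
    · rintro ⟨⟨h1, h2⟩, h3⟩
      refine ⟨h3, by rw [h2]; norm_num, fun k => ?_⟩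
      split_ifs
      · linarith [(h1 k.1).2]
      · linarith [(h1 k.1).1]
    · rintro ⟨h1, h2, h3⟩
      refine ⟨⟨fun k => ⟨?_, ?_⟩, by linarith⟩, h1⟩
      · have := h3 (k, false); simp at this; linarith
      · have := h3 (k, true); simp at this; linarith
  v σ p := (permPoint 3 σ, p)
  hv := by
    intro m p q a b hp hq ha hb hab
    ext1
    · change _ = a • permPoint 3 m + b • permPoint 3 m
      rw [← add_smul, hab, one_smul]
    · rfl
  vQ := fun m p hp => ⟨subset_convexHull ℝ _ ⟨m, rfl⟩, hp⟩
  πv := fun m p hp => rfl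
  gv := by
    rintro m p ⟨k, b⟩ hp
    simp only [permPoint3, Ihex]
    generalize m k = j
    cases b <;> fin_cases j <;> norm_num <;> decide
  comb := by
    rintro x ⟨hx1, hx2⟩
    rw [hex_eq] at hx1
    obtain ⟨wt, w1, w2, w3⟩ := hex_weights 1 2 3 (by norm_num) (by norm_num) x.1 hx1.1
      (by rw [hx1.2]; norm_num)
    refine ⟨wt, w1, w2, ?_⟩
    ext1
    · rw [Prod.fst_sum]
      simp only [Prod.smul_fst]
      ext k
      rw [w3 k, Finset.sum_apply]
      simp only [Pi.smul_apply, smul_eq_mul, permPoint3]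
    · rw [Prod.snd_sum]
      simp only [Prod.smul_snd]
      rw [← Finset.sum_smul, w2, one_smul]

end ConcreteFib


section BipFib
open Equiv Finset
variable {n : ℕ}

lemma permPoint_mul (u t : Perm (Fin n)) : permPoint n (u * t) = permPoint n u ∘ t := rfl

lemma bip_convex (w : Perm (Fin n)) : Convex ℝ (BIP n 1 w) := convex_convexHull ℝ _

/-- constructor -/
def bipFib {K M : Type} [Fintype M] (I : K → M → Prop) (w w' : Perm (Fin n)) (τ : M → Perm (Fin n))
    (hLI : ∀ u, BD u w ↔ ∃ m u', BD u' w' ∧ u = u' * τ m)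
    (π : (Fin n → ℝ) → (Fin n → ℝ)) (hπ : IsAff π) (g : K → (Fin n → ℝ) → ℝ) (hg : ∀ k, IsAff (g k))
    (πv : ∀ m p, p ∈ BIP n 1 w' → π (p ∘ τ m) = p)
    (gpos : ∀ m p k, p ∈ BIP n 1 w' → 0 ≤ g k (p ∘ τ m))
    (gv : ∀ m p k, p ∈ BIP n 1 w' → (g k (p ∘ τ m) = 0 ↔ I k m))
    (comb : ∀ x, π x ∈ BIP n 1 w' → (∀ k, 0 ≤ g k x) →
      ∃ c : M → ℝ, (∀ m, 0 ≤ c m) ∧ ∑ m, c m = 1 ∧ x = ∑ m, c m • (π x ∘ τ m)) :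
    Fib I (BIP n 1 w) (BIP n 1 w') :=
  have vQ : ∀ m p, p ∈ BIP n 1 w' → p ∘ τ m ∈ BIP n 1 w := by
    intro m p hp
    have : BIP n 1 w' ⊆ {p | p ∘ τ m ∈ BIP n 1 w} := by
      rw [BIP_eq w']
      apply convexHull_min
      · rintro _ ⟨u, hu, rfl⟩
        change permPoint n u ∘ τ m ∈ BIP n 1 w
        rw [← permPoint_mul, BIP_eq]
        exact subset_convexHull ℝ _ ⟨u * τ m, (hLI _).2 ⟨m, u, hu, rfl⟩, rfl⟩
      · intro x hx y hy a b ha hb hab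
        exact bip_convex w hx hy ha hb hab
    exact this hp
  have mem : ∀ x, x ∈ BIP n 1 w ↔ π x ∈ BIP n 1 w' ∧ (0:ℝ) = 0 ∧ ∀ k, 0 ≤ g k x := by
    intro x
    constructor
    · have : BIP n 1 w ⊆ {x | π x ∈ BIP n 1 w' ∧ (0:ℝ) = 0 ∧ ∀ k, 0 ≤ g k x} := by
        rw [BIP_eq w]
        apply convexHull_min
        · rintro _ ⟨u, hu, rfl⟩
          obtain ⟨m, u', hu', rfl⟩ := (hLI u).1 hu
          have hp : permPoint n u' ∈ BIP n 1 w' := by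
            rw [BIP_eq]; exact subset_convexHull ℝ _ ⟨u', hu', rfl⟩
          refine ⟨?_, rfl, fun k => ?_⟩
          · rw [permPoint_mul, πv m _ hp]; exact hp
          · rw [permPoint_mul]; exact gpos m _ k hp
        · intro x hx y hy a b ha hb hab
          refine ⟨?_, rfl, fun k => ?_⟩
          · rw [hπ _ _ _ _ hab]; exact bip_convex w' hx.1 hy.1 ha hb hab
          · rw [hg k _ _ _ _ hab]
            have h1 := hx.2.2 k
            have h2 := hy.2.2 k
            simp only [smul_eq_mul]
            positivity
      exact fun hx => this hx
    · rintro ⟨h1, -, h2⟩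
      obtain ⟨c, c0, c1, hc⟩ := comb x h1 h2
      rw [hc]
      exact (bip_convex w).sum_mem (fun m _ => c0 m) c1 (fun m _ => vQ m _ h1)
  { π := π
    hπ := hπ
    g := g
    hg := hg
    L := fun _ => 0
    hL := by intro x y a b hab; simp
    mem := mem
    v := fun m p => p ∘ τ m
    hv := fun m p q a b _ _ _ _ _ => rfl
    vQ := vQ
    πv := πv
    gv := gv
    comb := fun x hx => comb x ((mem x).1 hx).1 ((mem x).1 hx).2.2 }

/-- the coordinate at position `A` recovered from earlier ones -/
noncomputable def alph (A B : Fin n) (x : Fin n → ℝ) : ℝ :=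
  (∑ k ∈ univ.filter (fun k : Fin n => k.val < B.val), ((k:ℕ):ℝ) + (B:ℕ))
   - ∑ k ∈ univ.filter (fun k : Fin n => k.val < A.val), x k

lemma alph_aff (A B : Fin n) : IsAff (alph A B) := by
  intro x y a b hab
  unfold alph
  simp only [Pi.add_apply, Pi.smul_apply, smul_eq_mul, sum_add_distrib, ← mul_sum]
  linear_combination (-1) * (∑ k ∈ univ.filter (fun k : Fin n => k.val < B.val), ((k:ℕ):ℝ) + (B:ℕ)) * hab

lemma bip_ind (w : Perm (Fin n)) (S : Set (Fin n → ℝ)) (hS : Convex ℝ S)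
    (h : ∀ u, BD u w → permPoint n u ∈ S) {p : Fin n → ℝ} (hp : p ∈ BIP n 1 w) : p ∈ S := by
  rw [BIP_eq] at hp
  exact convexHull_min (by rintro _ ⟨u, hu, rfl⟩; exact h u hu) hS hp

lemma sum_filter_succ {A B : Fin n} (h : (B:ℕ) = A + 1) (x : Fin n → ℝ) :
    ∑ k ∈ univ.filter (fun k : Fin n => k.val < B.val), x k =
      ∑ k ∈ univ.filter (fun k : Fin n => k.val < A.val), x k + x A := by
  have : univ.filter (fun k : Fin n => k.val < B.val) =
      insert A (univ.filter (fun k : Fin n => k.val < A.val)) := by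
    ext k
    rw [mem_insert, mem_filter, mem_filter, Fin.ext_iff]
    simp only [mem_univ, true_and]
    omega
  rw [this, sum_insert (by simp)]; ring

lemma alph_eq {w : Perm (Fin n)} {A B : Fin n} (h : (B:ℕ) = A + 1) (hP : Pres w B)
    {p : Fin n → ℝ} (hp : p ∈ BIP n 1 w) : alph A B p = p A := by
  have : p ∈ {p : Fin n → ℝ | ∑ k ∈ univ.filter (fun k : Fin n => k.val < B.val), p k =
      ∑ k ∈ univ.filter (fun k : Fin n => k.val < B.val), ((k:ℕ):ℝ) + (B:ℕ)} := by
    apply bip_ind w _ _ _ hp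
    · intro x hx y hy a b ha hb hab
      have hx' : _ = _ := hx
      have hy' : _ = _ := hy
      change _ = _
      simp only [Pi.add_apply, Pi.smul_apply, smul_eq_mul, sum_add_distrib, ← mul_sum]
      rw [hx', hy', ← add_mul, hab, one_mul]
    · intro u hu
      have hPu := BD_Pres hu B.2.le hP
      have himg : (univ.filter fun k : Fin n => k.val < B.val).image u =
          univ.filter fun k : Fin n => k.val < B.val := by
        apply eq_of_subset_of_card_le
        · intro x hx
          obtain ⟨k, hk, rfl⟩ := mem_image.1 hx
          rw [mem_filter] at hk ⊢
          exact ⟨mem_univ _, hPu k hk.2⟩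
        · rw [card_image_of_injective _ u.injective]
      change _ = _
      unfold permPoint
      rw [sum_add_distrib]
      congr 1
      · conv_rhs => rw [← himg]
        rw [sum_image (fun x _ y _ h => u.injective h)]
      · rw [sum_const, Fin.card_filter_val_lt]; simp [B.2.le]
  have h' : _ = _ := this
  rw [sum_filter_succ h] at h'
  unfold alph
  linarith

lemma alph_congr {A B : Fin n} {x y : Fin n → ℝ} (h : ∀ k, k < A → x k = y k) : alph A B x = alph A B y := by
  unfold alph
  congr 1
  apply sum_congr rfl
  intro k hk
  rw [mem_filter] at hk
  exact h k hk.2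

lemma bip_lt {w : Perm (Fin n)} {B : Fin n} (hP : Pres w B) {p : Fin n → ℝ} (hp : p ∈ BIP n 1 w)
    (k : Fin n) : (k < B → p k ≤ (B:ℕ)) ∧ (B ≤ k → (B:ℕ) + 1 ≤ p k) := by
  have : p ∈ {p : Fin n → ℝ | (k < B → p k ≤ (B:ℕ)) ∧ (B ≤ k → ((B:ℕ):ℝ) + 1 ≤ p k)} := by
    apply bip_ind w _ _ _ hp
    · intro x hx y hy a b ha hb hab
      refine ⟨fun h => ?_, fun h => ?_⟩
      · exact (convex_Iic ((B:ℕ):ℝ)) (hx.1 h) (hy.1 h) ha hb hab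
      · exact (convex_Ici (((B:ℕ):ℝ)+1)) (hx.2 h) (hy.2 h) ha hb hab
    · intro u hu
      have hPu := BD_Pres hu B.2.le hP
      refine ⟨fun h => ?_, fun h => ?_⟩
      · have := hPu k h
        change ((u k:ℕ):ℝ)+1 ≤ ((B:ℕ):ℝ)
        exact_mod_cast this
      · have := Pres_ge hPu k h
        change ((B:ℕ):ℝ)+1 ≤ ((u k:ℕ):ℝ)+1
        exact_mod_cast Nat.succ_le_succ this
  exact this

/-- prism fibration -/
noncomputable def prismFib (w : Perm (Fin n)) {A B : Fin n} (h : (B:ℕ) = A + 1) (ha : w A < w B) (hP : Pres w B) :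
    Fib Iseg (BIP n 1 (w * swap A B)) (BIP n 1 w) := by
  have hAB : A ≠ B := by rintro rfl; omega
  have hAltB : A < B := by rw [Fin.lt_def]; omega
  have hα : ∀ (m : Bool) p, p ∈ BIP n 1 w →
      alph A B (p ∘ (if m then swap A B else 1 : Perm (Fin n))) = p A := by
    intro m p hp
    rw [← alph_eq h hP hp]
    apply alph_congr
    intro k hk
    cases m
    · simp
    · simp only [if_true, Function.comp]; rw [swap_apply_of_ne_of_ne hk.ne (hk.trans hAltB).ne]
  have hlt : ∀ p, p ∈ BIP n 1 w → p A < p B := by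
    intro p hp
    have h1 := (bip_lt hP hp A).1 hAltB
    have h2 := (bip_lt hP hp B).2 le_rfl
    linarith
  refine bipFib Iseg (w * swap A B) w (fun m => if m then swap A B else 1) ?_
    (fun x k => if k = A then alph A B x else if k = B then x A + x B - alph A B x else x k) ?_
    (fun k x => if k then x A + x B - alph A B x - x A else x A - alph A B x) ?_ ?_ ?_ ?_ ?_
  · intro u
    rw [BD_mul_iff h ha]
    constructor
    · rintro (hu | hu)
      · exact ⟨false, u, hu, by simp⟩
      · exact ⟨true, _, hu, by simp⟩
    · rintro ⟨m, u', hu', rfl⟩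
      cases m
      · left; simpa using hu'
      · right; simpa [mul_swap_swap] using hu'
  · intro x y a b hab
    ext k
    simp only [alph_aff A B _ _ _ _ hab, Pi.add_apply, Pi.smul_apply, smul_eq_mul]
    split_ifs <;> ring
  · intro k x y a b hab
    cases k <;> simp [alph_aff A B _ _ _ _ hab] <;> ring
  · intro m p hp
    ext k
    rw [hα m p hp]
    rcases eq_or_ne k A with rfl | h1
    · simp
    rcases eq_or_ne k B with rfl | h2
    · cases m <;> simp [hAB.symm]
    · cases m
      · simp [h1, h2]
      · simp [swap_apply_of_ne_of_ne h1 h2, h1, h2]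
  · intro m p k hp
    rw [hα m p hp]
    have := hlt p hp
    cases m <;> cases k <;> simp <;> linarith
  · intro m p k hp
    rw [hα m p hp]
    have := hlt p hp
    cases m <;> cases k <;> simp [Iseg] <;> intro <;> linarith
  · intro x hx hg
    have h1 := hlt _ hx
    have g0 := hg false
    have g1 := hg true
    simp only [if_true, if_neg hAB.symm] at h1
    simp only [if_true, if_false, Bool.false_eq_true] at g0 g1
    set α := alph A B x with hαd
    obtain ⟨t, ht⟩ : ∃ t, t * (x A + x B - α - α) = x A - α := by
      refine ⟨(x A - α) / (x A + x B - α - α), div_mul_cancel₀ _ (by linarith)⟩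
    have t0 : 0 ≤ t := by by_contra hh; nlinarith
    have t1 : t ≤ 1 := by by_contra hh; nlinarith
    refine ⟨fun b => if b then t else 1 - t, ?_, by simp, ?_⟩
    · intro b; cases b <;> simp [t0, t1]
    · ext k
      simp only [Fintype.sum_bool, if_true, Bool.false_eq_true, if_false, Pi.add_apply, Pi.smul_apply,
        Function.comp, smul_eq_mul, Perm.one_apply]
      rcases eq_or_ne k A with rfl | hkA
      · simp [hAB.symm]; linear_combination -ht
      rcases eq_or_ne k B with rfl | hkB
      · simp [hAB.symm]; linear_combination ht
      · simp [swap_apply_of_ne_of_ne hkA hkB, hkA, hkB]; ring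

end BipFib


section HexFib
open Equiv Finset
variable {n : ℕ}

def iota3 (A B C : Fin n) (hAB : A < B) (hBC : B < C) : Fin 3 ↪ Fin n where
  toFun := ![A, B, C]
  inj' := by
    have hAC := hAB.trans hBC
    intro i j hij
    fin_cases i <;> fin_cases j <;> simp at hij ⊢ <;> order

lemma S3_cases (σ : Perm (Fin 3)) : σ = 1 ∨ σ = swap 0 1 ∨ σ = swap 1 2 ∨ σ = swap 0 1 * swap 1 2 ∨
    σ = swap 1 2 * swap 0 1 ∨ σ = swap 0 1 * swap 1 2 * swap 0 1 := by
  revert σ; decide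

noncomputable def tau3 (A B C : Fin n) (hAB : A < B) (hBC : B < C) : Perm (Fin 3) →* Perm (Fin n) :=
  Equiv.Perm.viaEmbeddingHom (iota3 A B C hAB hBC)

section
variable {A B C : Fin n} {hAB : A < B} {hBC : B < C}

lemma tau3_apply (σ : Perm (Fin 3)) (k : Fin 3) :
    tau3 A B C hAB hBC σ (![A, B, C] k) = ![A, B, C] (σ k) :=
  Equiv.Perm.viaEmbedding_apply σ (iota3 A B C hAB hBC) k

lemma tau3_of_ne (σ : Perm (Fin 3)) (k : Fin n) (h1 : k ≠ A) (h2 : k ≠ B) (h3 : k ≠ C) :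
    tau3 A B C hAB hBC σ k = k := by
  refine Equiv.Perm.viaEmbedding_apply_of_notMem σ (iota3 A B C hAB hBC) k ?_
  rintro ⟨j, rfl⟩
  fin_cases j
  · exact h1 rfl
  · exact h2 rfl
  · exact h3 rfl

lemma fin_cases3 (A B C k : Fin n) : (∃ j, k = ![A, B, C] j) ∨ (k ≠ A ∧ k ≠ B ∧ k ≠ C) := by
  by_cases h1 : k = A
  · exact Or.inl ⟨0, h1⟩
  by_cases h2 : k = B
  · exact Or.inl ⟨1, h2⟩
  by_cases h3 : k = C
  · exact Or.inl ⟨2, h3⟩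
  exact Or.inr ⟨h1, h2, h3⟩

lemma tau3_01 : tau3 A B C hAB hBC (swap 0 1) = swap A B := by
  ext1 k
  rcases fin_cases3 A B C k with ⟨j, rfl⟩ | ⟨h1, h2, h3⟩
  · rw [tau3_apply]
    fin_cases j
    · simp
    · simp
    · simp [swap_apply_of_ne_of_ne (hAB.trans hBC).ne' hBC.ne']
      rfl
  · rw [tau3_of_ne _ _ h1 h2 h3, swap_apply_of_ne_of_ne h1 h2]

lemma tau3_12 : tau3 A B C hAB hBC (swap 1 2) = swap B C := by
  ext1 k
  rcases fin_cases3 A B C k with ⟨j, rfl⟩ | ⟨h1, h2, h3⟩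
  · rw [tau3_apply]
    fin_cases j
    · simp [swap_apply_of_ne_of_ne (hAB).ne (hAB.trans hBC).ne]
      rfl
    · simp
    · simp
  · rw [tau3_of_ne _ _ h1 h2 h3, swap_apply_of_ne_of_ne h2 h3]
end

lemma hexLI (x : Perm (Fin n)) {A B C : Fin n} (h : (B:ℕ) = A + 1) (h' : (C:ℕ) = B + 1)
    (hAB : A < B) (hBC : B < C) (ha : x A < x B) (hb : x B < x C) (u : Perm (Fin n)) :
    BD u (x * swap A B * swap B C * swap A B) ↔ ∃ m u', BD u' x ∧ u = u' * tau3 A B C hAB hBC m := by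
  have hAC := hAB.trans hBC
  rw [BD_mul_iff h (by simp [swap_apply_of_ne_of_ne hAB.ne hAC.ne, swap_apply_of_ne_of_ne hAC.ne' hBC.ne', hb]), BD_mul_iff h', BD_mul_iff h',
    BD_mul_iff h ha, BD_mul_iff h ha, BD_mul_iff h ha, BD_mul_iff h ha]
  rotate_left
  · simp [swap_apply_of_ne_of_ne hAC.ne' hBC.ne', ha.trans hb]
  · simp [swap_apply_of_ne_of_ne hAC.ne' hBC.ne', ha.trans hb]
  rw [← tau3_01 (hAB := hAB) (hBC := hBC), ← tau3_12 (hAB := hAB) (hBC := hBC)]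
  have key : ∀ σ ρ : Perm (Fin 3), BD (u * tau3 A B C hAB hBC σ) x →
    ∃ m u', BD u' x ∧ u = u' * tau3 A B C hAB hBC m := by
    intro σ _ hu
    exact ⟨σ⁻¹, _, hu, by rw [mul_assoc, ← map_mul, mul_inv_cancel, map_one, mul_one]⟩
  have h01 : swap (0:Fin 3) 1 * swap 0 1 = 1 := swap_mul_self _ _
  have h12 : swap (1:Fin 3) 2 * swap 1 2 = 1 := swap_mul_self _ _
  simp only [mul_assoc, ← map_mul]
  constructor
  · rintro (((hu | hu) | (hu | hu)) | ((hu | hu) | (hu | hu)))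
    · exact ⟨1, u, hu, by simp⟩
    all_goals exact key _ 1 hu
  · rintro ⟨m, u', hu', rfl⟩
    simp only [mul_assoc, ← map_mul]
    rcases S3_cases m with rfl | rfl | rfl | rfl | rfl | rfl
    · simp [hu']
    · left; left; right; rw [h01, map_one, mul_one]; exact hu'
    · left; right; left; rw [h12, map_one, mul_one]; exact hu'
    · left; right; right
      rw [show swap (0:Fin 3) 1 * swap 1 2 * (swap 1 2 * swap 0 1) = 1 by decide, map_one, mul_one]; exact hu'
    · right; right; left
      rw [show swap (1:Fin 3) 2 * swap 0 1 * (swap 0 1 * swap 1 2) = 1 by decide, map_one, mul_one]; exact hu'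
    · right; right; right
      rw [show swap (0:Fin 3) 1 * swap 1 2 * swap 0 1 * (swap 0 1 * (swap 1 2 * swap 0 1)) = 1 by decide, map_one, mul_one]; exact hu'

noncomputable def hexBipFib (x : Perm (Fin n)) {A B C : Fin n} (h : (B:ℕ) = A + 1) (h' : (C:ℕ) = B + 1)
    (ha : x A < x B) (hb : x B < x C) (hPB : Pres x B) (hPC : Pres x C) :
    Fib Ihex (BIP n 1 (x * swap A B * swap B C * swap A B)) (BIP n 1 x) := by
  have hAB : A < B := by rw [Fin.lt_def]; omega
  have hBC : B < C := by rw [Fin.lt_def]; omega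
  have hAC := hAB.trans hBC
  have hC' : ((C:ℕ):ℝ) = (B:ℕ) + 1 := by exact_mod_cast h'
  have hα : ∀ (σ : Perm (Fin 3)) p, p ∈ BIP n 1 x →
      alph A B (p ∘ tau3 A B C hAB hBC σ) = p A := by
    intro m p hp
    rw [← alph_eq h hPB hp]
    apply alph_congr
    intro k hk
    simp only [Function.comp]
    rw [tau3_of_ne _ _ hk.ne (hk.trans hAB).ne (hk.trans hAC).ne]
  have hpA : ∀ p, p ∈ BIP n 1 x → p A ≤ (B:ℕ) := fun p hp => (bip_lt hPB hp A).1 hAB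
  have hpB : ∀ p, p ∈ BIP n 1 x → p B = (B:ℕ) + 1 := by
    intro p hp
    have h1 := (bip_lt hPB hp B).2 le_rfl
    have h2 := (bip_lt hPC hp B).1 hBC
    linarith
  have hpC : ∀ p, p ∈ BIP n 1 x → (B:ℕ) + 2 ≤ p C := by
    intro p hp
    have h1 := (bip_lt hPC hp C).2 le_rfl
    linarith
  have hsum : ∀ (σ : Perm (Fin 3)) (p : Fin n → ℝ), p (tau3 A B C hAB hBC σ A) + p (tau3 A B C hAB hBC σ B)
      + p (tau3 A B C hAB hBC σ C) = p A + p B + p C := by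
    intro σ p
    have h1 := Equiv.sum_comp σ (fun j => p (![A, B, C] j))
    simp only [Fin.sum_univ_three, ← tau3_apply (hAB := hAB) (hBC := hBC)] at h1
    simpa using h1
  have hg1 : ∀ (σ : Perm (Fin 3)) (p : Fin n → ℝ) (k : Fin 3), (p ∘ tau3 A B C hAB hBC σ) (![A,B,C] k) =
      p (![A,B,C] (σ k)) := by
    intro σ p k
    rw [Function.comp, tau3_apply]
  refine bipFib Ihex _ x (fun m => tau3 A B C hAB hBC m) (hexLI x h h' hAB hBC ha hb)
    (fun x k => if k = A then alph A B x else if k = B then (B:ℕ) + 1 else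
      if k = C then x A + x B + x C - alph A B x - ((B:ℕ) + 1) else x k) ?_
    (fun k x => if k.2 then (x A + x B + x C - alph A B x - ((B:ℕ) + 1)) - x (![A,B,C] k.1)
      else x (![A,B,C] k.1) - alph A B x) ?_ ?_ ?_ ?_ ?_
  · intro x y a b hab
    ext k
    simp only [alph_aff A B _ _ _ _ hab, Pi.add_apply, Pi.smul_apply, smul_eq_mul]
    split_ifs
    · ring
    · linear_combination (-((B:ℕ):ℝ) - 1) * hab
    · linear_combination (((B:ℕ):ℝ) + 1) * hab
    · ring
  · rintro ⟨k, b⟩ x y a c hab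
    cases b <;> simp [alph_aff A B _ _ _ _ hab]
    · ring
    · linear_combination (((B:ℕ):ℝ) + 1) * hab
  · intro m p hp
    ext k
    rw [hα m p hp]
    have h1 := hsum m p
    have h2 := hpB p hp
    simp only [Function.comp]
    rcases eq_or_ne k A with rfl | hk1
    · simp
    rcases eq_or_ne k B with rfl | hk2
    · simp [hk1, h2]
    rcases eq_or_ne k C with rfl | hk3
    · simp only [if_neg hk1, if_neg hk2, if_true]; linarith
    · simp only [if_neg hk1, if_neg hk2, if_neg hk3]; rw [tau3_of_ne _ _ hk1 hk2 hk3]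
  · rintro m p ⟨k, b⟩ hp
    simp only
    rw [hα m p hp, hg1]
    have h1 := hsum m p
    have h2 := hpB p hp
    have h3 := hpA p hp
    have h4 := hpC p hp
    simp only [Function.comp]
    rw [h1]
    generalize m k = j
    cases b <;> fin_cases j <;> simp <;> linarith
  · rintro m p ⟨k, b⟩ hp
    simp only
    rw [hα m p hp, hg1]
    have h1 := hsum m p
    have h2 := hpB p hp
    have h3 := hpA p hp
    have h4 := hpC p hp
    simp only [Function.comp, Ihex]
    rw [h1]
    generalize m k = j
    have e1 : p B - p A ≠ 0 := by intro h; linarith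
    have e2 : p C - p A ≠ 0 := by intro h; linarith
    have e3 : p A + p B + p C - p A - ((B:ℕ)+1) - p A ≠ 0 := by intro h; linarith
    have e4 : p A + p B + p C - p A - ((B:ℕ)+1) - p B ≠ 0 := by intro h; linarith
    have e5 : p A + p B + p C - p A - ((B:ℕ)+1) - p C = 0 := by linarith
    cases b <;> fin_cases j <;> simp [e1, e2, e3, e4, e5]
  · intro x hx hg
    have h3 := hpA _ hx
    have h4 := hpC _ hx
    simp only [if_true, if_neg hAC.ne', if_neg hBC.ne'] at h3 h4
    set α := alph A B x with hαd
    obtain ⟨wt, w1, w2, w3⟩ := hex_weights α ((B:ℕ)+1) (x A + x B + x C - α - ((B:ℕ) + 1))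
      (by linarith) (by linarith) (fun k => x (![A,B,C] k))
      (fun k => ⟨by have := hg (k, false); simp at this; linarith,
        by have := hg (k, true); simp at this; linarith⟩)
      (by simp)
    refine ⟨wt, w1, w2, ?_⟩
    ext k
    rw [Finset.sum_apply]
    simp only [Pi.smul_apply, smul_eq_mul]
    rcases fin_cases3 A B C k with ⟨j, rfl⟩ | ⟨hk1, hk2, hk3⟩
    · rw [w3 j]
      apply sum_congr rfl
      intro σ _
      rw [hg1]
      generalize σ j = i
      fin_cases i <;> simp [hAB.ne', hAC.ne', hBC.ne']
    · simp only [Function.comp]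
      simp_rw [tau3_of_ne _ _ hk1 hk2 hk3, if_neg hk1, if_neg hk2, if_neg hk3]
      rw [← sum_mul, w2, one_mul]

end HexFib


section Backward
open Equiv Finset
variable {n : ℕ}

lemma NF_singleton {E : Type*} [AddCommGroup E] [Module ℝ E] (a : E) (F : NF ({a} : Set E)) : F.1 = {a} := by
  obtain ⟨F, hF, y, hy⟩ := F
  have hs := hF.1.subset
  have : y = a := hs hy
  subst this
  exact Set.Subset.antisymm hs (Set.singleton_subset_iff.2 hy)

lemma CombEquiv_singleton {E F : Type*} [AddCommGroup E] [Module ℝ E] [AddCommGroup F] [Module ℝ F]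
    (a : E) (b : F) : CombEquiv ({a} : Set E) ({b} : Set F) := by
  apply CombEquiv_of_NF
  refine { toFun := fun _ => ⟨{b}, ⟨IsExtreme.refl ℝ _, convex_singleton b⟩, Set.singleton_nonempty b⟩
           invFun := fun _ => ⟨{a}, ⟨IsExtreme.refl ℝ _, convex_singleton a⟩, Set.singleton_nonempty a⟩
           left_inv := fun x => Subtype.ext (NF_singleton a x).symm
           right_inv := fun x => Subtype.ext (NF_singleton b x).symm
           map_rel_iff' := ?_ }
  intro x y
  have : x = y := Subtype.ext ((NF_singleton a x).trans (NF_singleton a y).symm)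
  simp [this]

lemma BIP_one : BIP n 1 1 = {permPoint n 1} := by
  rw [BIP_eq]
  have : {u : Perm (Fin n) | BD u 1} = {1} := by
    ext u
    have := mem_LI (u := u) (w := 1)
    rw [LI_one, mem_singleton] at this
    exact this.symm
  rw [this, Set.image_singleton, convexHull_singleton]

lemma cube_zero : cubeS 0 = {0} := by
  ext x
  simp [Subsingleton.elim x 0]

theorem C0_cube : ∀ (m : ℕ) (w : Perm (Fin n)), invN w = m → C0 w → CombEquiv (BIP n 1 w) (cubeS m) := by
  intro m
  induction m with
  | zero =>
    intro w hw hc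
    rcases C0_factor w hc with rfl | ⟨A, B, w', h, ha, rfl, hP, hc'⟩
    · rw [BIP_one, cube_zero]
      exact CombEquiv_singleton _ _
    · rw [invN_mul_swap w' h ha] at hw; omega
  | succ m ih =>
    intro w hw hc
    rcases C0_factor w hc with rfl | ⟨A, B, w', h, ha, rfl, hP, hc'⟩
    · rw [invN_one] at hw; omega
    · rw [invN_mul_swap w' h ha] at hw
      exact (prismFib w' h ha hP).comb_equiv (cubeFib m) (bip_convex _) (cube_convex m)
        (ih w' (by omega) hc')

theorem C1_hex : ∀ (m : ℕ) (w : Perm (Fin n)), invN w = m → C1 w →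
    3 ≤ m ∧ CombEquiv (BIP n 1 w) (Perm2Hex ×ˢ cubeS (m - 3)) := by
  intro m
  induction m with
  | zero =>
    intro w hw hc
    rcases C1_factor w hc with ⟨A, B, w', h, ha, rfl, hP, hc'⟩ | ⟨A, B, C, x, h, h', ha, hb, hPB, hPC, hc', rfl⟩
    · rw [invN_mul_swap w' h ha] at hw; omega
    · have hAB : A < B := by rw [Fin.lt_def]; omega
      have hBC : B < C := by rw [Fin.lt_def]; omega
      have hAC := hAB.trans hBC
      rw [invN_mul_swap _ h (by simp [swap_apply_of_ne_of_ne hAB.ne hAC.ne, swap_apply_of_ne_of_ne hAC.ne' hBC.ne', hb])] at hw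
      omega
  | succ m ih =>
    intro w hw hc
    rcases C1_factor w hc with ⟨A, B, w', h, ha, rfl, hP, hc'⟩ | ⟨A, B, C, x, h, h', ha, hb, hPB, hPC, hc', rfl⟩
    · rw [invN_mul_swap w' h ha] at hw
      obtain ⟨h3, hE⟩ := ih w' (by omega) hc'
      refine ⟨by omega, ?_⟩
      rw [show m + 1 - 3 = m - 3 + 1 by omega]
      exact (prismFib w' h ha hP).comb_equiv (prodFib Perm2Hex (cubeFib (m-3))) (bip_convex _)
        (hex_convex.prod (cube_convex _)) hE
    · have hAB : A < B := by rw [Fin.lt_def]; omega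
      have hBC : B < C := by rw [Fin.lt_def]; omega
      have hAC := hAB.trans hBC
      rw [invN_mul_swap _ h (by simp [swap_apply_of_ne_of_ne hAB.ne hAC.ne, swap_apply_of_ne_of_ne hAC.ne' hBC.ne', hb]),
        invN_mul_swap _ h' (by simp [swap_apply_of_ne_of_ne hAC.ne' hBC.ne', ha.trans hb]),
        invN_mul_swap _ h ha] at hw
      refine ⟨by omega, ?_⟩
      exact (hexBipFib x h h' ha hb hPB hPC).comb_equiv (hexFib (m + 1 - 3)) (bip_convex _) (cube_convex _)
        (C0_cube _ x (by omega) hc')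

end Backward


section Counting
open Finset
variable {E : Type*} [AddCommGroup E] [Module ℝ E]

lemma extreme_sum {Q F : Set E} (hQ : Convex ℝ Q) (hF : IsExtreme ℝ Q F) {M : Type*} [Fintype M]
    (c : M → ℝ) (z : M → E) (c0 : ∀ m, 0 ≤ c m) (c1 : ∑ m, c m = 1) (hz : ∀ m, z m ∈ Q)
    (hs : ∑ m, c m • z m ∈ F) (m0 : M) (hm : 0 < c m0) : z m0 ∈ F := by
  classical
  have e1 : c m0 + ∑ m ∈ univ.erase m0, c m = 1 := by rw [add_sum_erase _ _ (mem_univ _), c1]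
  have e2 : c m0 • z m0 + ∑ m ∈ univ.erase m0, c m • z m = ∑ m, c m • z m :=
    add_sum_erase _ (fun m => c m • z m) (mem_univ _)
  have hnn : 0 ≤ ∑ m ∈ univ.erase m0, c m := sum_nonneg fun m _ => c0 m
  rcases hnn.eq_or_lt with h | h
  · have hz0 : ∀ m ∈ univ.erase m0, c m = 0 :=
      (sum_eq_zero_iff_of_nonneg fun m _ => c0 m).1 h.symm
    have : ∑ m ∈ univ.erase m0, c m • z m = 0 := sum_eq_zero fun m hm => by rw [hz0 m hm, zero_smul]
    rw [this, show c m0 = 1 by linarith, one_smul, add_zero] at e2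
    rw [e2]; exact hs
  · set s := ∑ m ∈ univ.erase m0, c m with hsd
    have hr : ∑ m ∈ univ.erase m0, (c m / s) • z m ∈ Q := by
      apply hQ.sum_mem (fun m _ => div_nonneg (c0 m) hnn) _ (fun m _ => hz m)
      rw [← sum_div, div_self h.ne']
    refine hF.left_mem_of_mem_openSegment (hz m0) hr hs ⟨c m0, s, hm, h, e1, ?_⟩
    rw [← e2, smul_sum]
    congr 1
    apply sum_congr rfl
    intro m _
    rw [smul_smul, mul_div_cancel₀ _ h.ne']

lemma hull_range {M : Type*} [Fintype M] (V : M → E) {x : E} (hx : x ∈ convexHull ℝ (Set.range V)) :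
    ∃ c : M → ℝ, (∀ m, 0 ≤ c m) ∧ ∑ m, c m = 1 ∧ ∑ m, c m • V m = x := by
  classical
  have : convexHull ℝ (Set.range V) ⊆
      {x | ∃ c : M → ℝ, (∀ m, 0 ≤ c m) ∧ ∑ m, c m = 1 ∧ ∑ m, c m • V m = x} := by
    apply convexHull_min
    · rintro _ ⟨m, rfl⟩
      refine ⟨fun k => if k = m then 1 else 0, fun k => by dsimp only; split_ifs <;> norm_num, by simp, by simp⟩
    · rintro x ⟨c, h1, h2, rfl⟩ y ⟨d, h3, h4, rfl⟩ a b ha hb hab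
      refine ⟨fun m => a * c m + b * d m, fun m => ?_, ?_, ?_⟩
      · have := h1 m; have := h3 m; positivity
      · rw [sum_add_distrib, ← mul_sum, ← mul_sum, h2, h4]; linarith
      · simp only [add_smul, mul_smul, sum_add_distrib, smul_sum]
  exact this hx

/-- minimal nonempty faces -/
noncomputable def minFaces {M : Type*} [Fintype M] (V : M → E) (hV : Function.Injective V)
    (hE : ∀ m, IsFaceOf (convexHull ℝ (Set.range V)) {V m}) :
    M ≃ {F : NF (convexHull ℝ (Set.range V)) // IsMin F} := by
  refine Equiv.ofBijective (fun m => ⟨⟨{V m}, hE m, Set.singleton_nonempty _⟩, ?_⟩) ⟨?_, ?_⟩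
  · rintro ⟨F, hF, y, hy⟩ hle x hx
    have h1 : y = V m := hle hy
    have h2 : x = V m := hx
    rw [h2, ← h1]; exact hy
  · intro m m' h
    have : ({V m} : Set E) = {V m'} := congrArg (fun F => F.1.1) h
    exact hV (Set.singleton_injective this)
  · rintro ⟨⟨F, hF, x, hx⟩, hmin⟩
    obtain ⟨c, c0, c1, hc⟩ := hull_range V (hF.1.subset hx)
    obtain ⟨m, -, hm⟩ : ∃ m ∈ univ, 0 < c m := by
      apply exists_lt_of_sum_lt
      rw [c1]; simp
    have hmF : V m ∈ F := extreme_sum (convex_convexHull ℝ _) hF.1 c V c0 c1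
      (fun m => subset_convexHull ℝ _ ⟨m, rfl⟩) (by rw [hc]; exact hx) m hm
    refine ⟨m, ?_⟩
    apply Subtype.ext
    have hle : (⟨{V m}, hE m, Set.singleton_nonempty _⟩ : NF (convexHull ℝ (Set.range V))) ≤ ⟨F, hF, x, hx⟩ :=
      Set.singleton_subset_iff.2 hmF
    exact le_antisymm hle (hmin hle)

/-- a simple vertex -/
def SimpleAt (Q : Set E) (v : E) (J : Type) [Fintype J] [DecidableEq J] : Prop :=
  v ∈ Q ∧ ∃ (d : J → E) (f : J → E →ₗ[ℝ] ℝ), (∀ j, v + d j ∈ Q) ∧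
    (∀ i j, f i (d j) = if i = j then 1 else 0) ∧
    ∀ x ∈ Q, (∀ j, 0 ≤ f j (x - v)) ∧ x - v = ∑ j, f j (x - v) • d j

variable {Q : Set E} {v : E} {J : Type} [Fintype J] [DecidableEq J]

lemma simple_face_of (hQ : Convex ℝ Q) (f : J → E →ₗ[ℝ] ℝ)
    (hf : ∀ x ∈ Q, ∀ j, 0 ≤ f j (x - v)) (S : Set J) :
    IsFaceOf Q {x | x ∈ Q ∧ ∀ j, j ∉ S → f j (x - v) = 0} := by
  have key : ∀ (j : J) (x y : E) (a b : ℝ), a + b = 1 →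
      f j (a • x + b • y - v) = a * f j (x - v) + b * f j (y - v) := by
    intro j x y a b hab
    have : a • x + b • y - v = a • (x - v) + b • (y - v) := by
      rw [smul_sub, smul_sub]
      have : v = a • v + b • v := by rw [← add_smul, hab, one_smul]
      nth_rewrite 1 [this]; abel
    rw [this]; simp
  refine ⟨⟨fun x hx => hx.1, ?_⟩, ?_⟩
  · rintro x hx y hy z ⟨hz, hz0⟩ ⟨a, b, ha, hb, hab, rfl⟩
    refine ⟨hx, fun j hj => ?_⟩
    have h1 := hz0 j hj
    rw [key j x y a b hab] at h1
    have h2 := hf x hx j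
    have h3 := hf y hy j
    have : a * f j (x - v) = 0 := by
      have := mul_nonneg ha.le h2
      have := mul_nonneg hb.le h3
      linarith
    exact (mul_eq_zero.1 this).resolve_left ha.ne'
  · rintro x ⟨hx, hx0⟩ y ⟨hy, hy0⟩ a b ha hb hab
    refine ⟨hQ hx hy ha hb hab, fun j hj => ?_⟩
    rw [key j x y a b hab, hx0 j hj, hy0 j hj]; ring

lemma simple_face_eq (hQ : Convex ℝ Q) (hv : v ∈ Q) (d : J → E) (f : J → E →ₗ[ℝ] ℝ)
    (hd : ∀ j, v + d j ∈ Q)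
    (hf : ∀ x ∈ Q, (∀ j, 0 ≤ f j (x - v)) ∧ x - v = ∑ j, f j (x - v) • d j)
    {F : Set E} (hF : IsFaceOf Q F) (hvF : v ∈ F) :
    F = {x | x ∈ Q ∧ ∀ j, j ∉ {j | v + d j ∈ F} → f j (x - v) = 0} := by
  have main : ∀ x ∈ Q, ∃ N : ℝ, 1 < N ∧ ∃ c : Option J → ℝ, (∀ m, 0 ≤ c m) ∧ ∑ m, c m = 1 ∧
      (∀ j, c (some j) = f j (x - v) / N) ∧ 0 < c none ∧
      ∑ m, c m • (Option.elim m v (fun j => v + d j)) = v + (1/N) • (x - v) := by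
    intro x hx
    obtain ⟨h0, h1⟩ := hf x hx
    have hs : 0 ≤ ∑ j, f j (x - v) := sum_nonneg fun j _ => h0 j
    set s := ∑ j, f j (x - v) with hsd
    have hN : (s + 2) ≠ 0 := by positivity
    refine ⟨s + 2, by linarith, fun m => Option.elim m (2 / (s+2)) (fun j => f j (x - v) / (s + 2)),
      ?_, ?_, fun j => rfl, by simp only [Option.elim]; positivity, ?_⟩
    · rintro (_ | j)
      · simp only [Option.elim]; positivity
      · have := h0 j; simp only [Option.elim]; positivity
    · rw [Fintype.sum_option]
      simp only [Option.elim]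
      rw [← sum_div, ← hsd]; field_simp; ring
    · rw [Fintype.sum_option]
      simp only [Option.elim, smul_add, sum_add_distrib]
      rw [← sum_smul, ← sum_div, ← hsd, ← add_assoc, ← add_smul]
      rw [show 2 / (s+2) + s / (s+2) = 1 by field_simp; ring, one_smul]
      congr 1
      conv_rhs => rw [h1]
      rw [smul_sum]
      apply sum_congr rfl
      intro j _
      rw [smul_smul]; congr 1; ring
  apply Set.Subset.antisymm
  · intro x hx
    refine ⟨hF.1.subset hx, fun j hj => ?_⟩
    by_contra hne
    have hxQ := hF.1.subset hx
    obtain ⟨N, hN, c, c0, c1, c2, -, c3⟩ := main x hxQ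
    have hpos := lt_of_le_of_ne ((hf x hxQ).1 j) (Ne.symm hne)
    apply hj
    refine extreme_sum hQ hF.1 c (fun m => Option.elim m v (fun j => v + d j)) c0 c1 ?_ ?_ (some j) ?_
    · rintro (_ | j)
      · exact hv
      · exact hd j
    · rw [c3]
      have : v + (1/N) • (x - v) = (1 - 1/N) • v + (1/N) • x := by
        rw [smul_sub, sub_smul, one_smul]; abel
      rw [this]
      have : 1/N ≤ 1 := by rw [div_le_one (by linarith)]; linarith
      exact hF.2 hvF hx (by linarith) (by positivity) (by ring)
    · rw [c2]; apply div_pos hpos; linarith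
  · rintro x ⟨hxQ, hx⟩
    obtain ⟨N, hN, c, c0, c1, c2, cn, c3⟩ := main x hxQ
    have hmem : v + (1/N) • (x - v) ∈ F := by
      rw [← c3, ← sum_filter_of_ne (p := fun m => c m ≠ 0)]
      · apply hF.2.sum_mem (fun m _ => c0 m)
        · rw [sum_filter_ne_zero, c1]
        · rintro (_ | j) hm
          · exact hvF
          · rw [mem_filter, c2] at hm
            by_contra hj
            apply hm.2
            rw [hx j hj, zero_div]
      · intro m _ h h'
        apply h; rw [h', zero_smul]
    have l1 : 1/N < 1 := by rw [div_lt_one (by linarith)]; linarith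
    refine hF.1.right_mem_of_mem_openSegment hv hxQ hmem ⟨1 - 1/N, 1/N, by linarith, by positivity, by ring, ?_⟩
    rw [smul_sub, sub_smul, one_smul]; abel

lemma simple_singleton (hQ : Convex ℝ Q) (h : SimpleAt Q v J) : IsFaceOf Q {v} := by
  obtain ⟨hv, d, f, hd, hfd, hf⟩ := h
  have := simple_face_of hQ f (fun x hx => (hf x hx).1) ∅
  convert this using 1
  ext x
  constructor
  · rintro rfl
    exact ⟨hv, fun j _ => by simp⟩
  · rintro ⟨hx, h0⟩
    have := (hf x hx).2
    rw [sum_eq_zero (fun j _ => by rw [h0 j (by simp), zero_smul])] at this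
    exact sub_eq_zero.1 this

lemma simple_count (hQ : Convex ℝ Q) (h : SimpleAt Q v J) :
    Nat.card {F : NF Q // v ∈ F.1} = 2 ^ Fintype.card J := by
  obtain ⟨hv, d, f, hd, hfd, hf⟩ := h
  have e : {F : NF Q // v ∈ F.1} ≃ Set J :=
    { toFun := fun F => {j | v + d j ∈ F.1.1}
      invFun := fun S => ⟨⟨{x | x ∈ Q ∧ ∀ j, j ∉ S → f j (x - v) = 0},
        simple_face_of hQ f (fun x hx => (hf x hx).1) S, ⟨v, hv, fun j _ => by simp⟩⟩,
          ⟨hv, fun j _ => by simp⟩⟩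
      left_inv := by
        rintro ⟨⟨F, hF, hne⟩, hvF⟩
        apply Subtype.ext
        apply Subtype.ext
        exact (simple_face_eq hQ hv d f hd hf hF hvF).symm
      right_inv := by
        intro S
        ext j
        constructor
        · rintro ⟨h1, h2⟩
          by_contra hj
          have := h2 j hj
          rw [add_sub_cancel_left, hfd] at this
          simp at this
        · intro hj
          refine ⟨hd j, fun i hi => ?_⟩
          rw [add_sub_cancel_left, hfd, if_neg]
          rintro rfl
          exact hi hj }
  rw [Nat.card_congr e, Nat.card_eq_fintype_card, Fintype.card_set]

lemma SimpleAt.prod {E' : Type*} [AddCommGroup E'] [Module ℝ E'] {Q' : Set E'} {v' : E'}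
    {J' : Type} [Fintype J'] [DecidableEq J'] (h : SimpleAt Q v J) (h' : SimpleAt Q' v' J') :
    SimpleAt (Q ×ˢ Q') (v, v') (J ⊕ J') := by
  obtain ⟨hv, d, f, hd, hfd, hf⟩ := h
  obtain ⟨hv', d', f', hd', hfd', hf'⟩ := h'
  refine ⟨⟨hv, hv'⟩, Sum.elim (fun j => (d j, 0)) (fun j => (0, d' j)),
    Sum.elim (fun j => (f j).comp (LinearMap.fst ℝ E E')) (fun j => (f' j).comp (LinearMap.snd ℝ E E')), ?_, ?_, ?_⟩
  · rintro (j | j)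
    · exact ⟨hd j, by simpa using hv'⟩
    · exact ⟨by simpa using hv, hd' j⟩
  · rintro (i | i) (j | j) <;> simp [hfd, hfd']
  · rintro ⟨x, x'⟩ ⟨hx, hx'⟩
    refine ⟨?_, ?_⟩
    · rintro (j | j)
      · simpa using (hf x hx).1 j
      · simpa using (hf' x' hx').1 j
    · rw [Fintype.sum_sum_type]
      ext1
      · simpa [Prod.fst_sum] using (hf x hx).2
      · simpa [Prod.snd_sum] using (hf' x' hx').2

end Counting


section Transport
open Finset
variable {E : Type*} [AddCommGroup E] [Module ℝ E] {E' : Type*} [AddCommGroup E'] [Module ℝ E']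

theorem transport {M M' : Type*} [Fintype M] [Fintype M'] (V : M → E) (V' : M' → E')
    (hV : Function.Injective V) (hV' : Function.Injective V')
    (hE : ∀ m, IsFaceOf (convexHull ℝ (Set.range V)) {V m})
    (hE' : ∀ m, IsFaceOf (convexHull ℝ (Set.range V')) {V' m})
    (h : CombEquiv (convexHull ℝ (Set.range V)) (convexHull ℝ (Set.range V'))) :
    Fintype.card M = Fintype.card M' ∧ ∀ m, ∃ m',
      Nat.card {F : NF (convexHull ℝ (Set.range V)) // V m ∈ F.1} =
      Nat.card {F : NF (convexHull ℝ (Set.range V')) // V' m' ∈ F.1} := by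
  obtain ⟨e⟩ := NF_of_CombEquiv h
  have hmin : ∀ F, IsMin F ↔ IsMin (e F) := by
    intro F
    constructor
    · intro hF G hG
      have := hF (b := e.symm G) (by rwa [e.symm_apply_le])
      rwa [e.le_symm_apply] at this
    · intro hF G hG
      have := hF (b := e G) (e.monotone hG)
      exact e.le_iff_le.1 this
  have e2 := e.toEquiv.subtypeEquiv (p := fun F => IsMin F) (q := fun F => IsMin F) hmin
  refine ⟨Fintype.card_congr ((minFaces V hV hE).trans (e2.trans (minFaces V' hV' hE').symm)), fun m => ?_⟩
  have hm : IsMin (e ((minFaces V hV hE m).1)) := (hmin _).1 (minFaces V hV hE m).2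
  obtain ⟨m', hm'⟩ := (minFaces V' hV' hE').surjective ⟨_, hm⟩
  refine ⟨m', Nat.card_congr (e.toEquiv.subtypeEquiv fun F => ?_)⟩
  have h1 : V m ∈ F.1 ↔ (minFaces V hV hE m).1 ≤ F := Set.singleton_subset_iff.symm
  have h2 : V' m' ∈ (e F).1 ↔ (minFaces V' hV' hE' m').1 ≤ e F := Set.singleton_subset_iff.symm
  change V m ∈ F.1 ↔ V' m' ∈ (e F).1
  rw [h1, h2, hm', e.le_iff_le]

lemma exposed_face {M : Type*} [Fintype M] (V : M → E) (m0 : M) (φ : E →ₗ[ℝ] ℝ)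
    (h : ∀ m, m ≠ m0 → φ (V m) < φ (V m0)) : IsFaceOf (convexHull ℝ (Set.range V)) {V m0} := by
  classical
  have key : ∀ x ∈ convexHull ℝ (Set.range V), φ x ≤ φ (V m0) ∧ (φ x = φ (V m0) → x = V m0) := by
    intro x hx
    obtain ⟨c, c0, c1, rfl⟩ := hull_range V hx
    have hs : φ (V m0) - φ (∑ m, c m • V m) = ∑ m, c m * (φ (V m0) - φ (V m)) := by
      simp only [map_sum, map_smul, smul_eq_mul, mul_sub, sum_sub_distrib, ← sum_mul, c1, one_mul]
    have hnn : ∀ m ∈ univ, 0 ≤ c m * (φ (V m0) - φ (V m)) := by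
      intro m _
      apply mul_nonneg (c0 m)
      rcases eq_or_ne m m0 with rfl | hm
      · simp
      · linarith [h m hm]
    refine ⟨by linarith [sum_nonneg hnn], fun heq => ?_⟩
    rw [heq, sub_self] at hs
    have h0 := (sum_eq_zero_iff_of_nonneg hnn).1 hs.symm
    have hc : ∀ m, m ≠ m0 → c m = 0 := by
      intro m hm
      have := h0 m (mem_univ _)
      rcases mul_eq_zero.1 this with h' | h'
      · exact h'
      · linarith [h m hm]
    rw [sum_eq_single m0 (fun m _ hm => hc m hm) (by simp)] at c1
    rw [sum_eq_single m0 (fun m _ hm => by rw [hc m hm, zero_smul]) (by simp), c1, one_smul]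
  refine ⟨⟨Set.singleton_subset_iff.2 (subset_convexHull ℝ _ ⟨m0, rfl⟩), ?_⟩, convex_singleton _⟩
  rintro x hx y hy z hz ⟨a, b, ha, hb, hab, rfl⟩
  have hz' : _ = _ := hz
  have h1 : a * φ x + b * φ y = φ (V m0) := by rw [← hz']; simp
  have h2 := (key x hx).1
  have h3 := (key y hy).1
  apply (key x hx).2
  have h4 : a * φ x + b * φ y = a * φ (V m0) + b * φ (V m0) := by rw [h1, ← add_mul, hab, one_mul]
  nlinarith [mul_le_mul_of_nonneg_left h3 hb.le, mul_le_mul_of_nonneg_left h2 ha.le]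
end Transport

section HexCube
open Finset

/-- vertices of the cube -/
def cv {m : ℕ} (ε : Fin m → Bool) : Fin m → ℝ := fun k => if ε k then 1 else 0

lemma cv_inj {m : ℕ} : Function.Injective (cv (m := m)) := by
  intro a b h
  ext k
  have := congrFun h k
  unfold cv at this
  cases ha : a k <;> cases hb : b k <;> simp [ha, hb] at this ⊢

lemma cube_hull (m : ℕ) : cubeS m = convexHull ℝ (Set.range (cv (m := m))) := by
  have h1 : Set.range (cv (m := m)) = Set.univ.pi (fun _ => ({0, 1} : Set ℝ)) := by
    ext x
    rw [Set.mem_univ_pi]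
    constructor
    · rintro ⟨ε, rfl⟩ k
      unfold cv
      split_ifs <;> simp
    · intro h
      refine ⟨fun k => decide (x k = 1), ?_⟩
      ext k
      rcases h k with h | h
      · simp [cv, h]
      · have : x k = 1 := h
        simp [cv, this]
  rw [h1, convexHull_pi]
  ext x
  rw [Set.mem_univ_pi]
  simp only [convexHull_pair, segment_eq_Icc (zero_le_one' ℝ)]
  rfl

lemma cube_simple {m : ℕ} (ε : Fin m → Bool) : SimpleAt (cubeS m) (cv ε) (Fin m) := by
  refine ⟨fun k => by unfold cv; split_ifs <;> simp, fun j => Pi.single j (if ε j then -1 else 1),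
    fun j => (if ε j then (-1:ℝ) else 1) • LinearMap.proj j, ?_, ?_, ?_⟩
  · intro j k
    rcases eq_or_ne k j with rfl | h
    · simp only [Pi.add_apply, Pi.single_eq_same, cv]
      split_ifs <;> simp
    · simp only [Pi.add_apply, Pi.single_eq_of_ne h, cv]
      split_ifs <;> simp
  · intro i j
    rcases eq_or_ne i j with rfl | h
    · simp only [LinearMap.smul_apply, LinearMap.proj_apply, Pi.single_eq_same, smul_eq_mul, if_true]
      split_ifs <;> norm_num
    · simp only [LinearMap.smul_apply, LinearMap.proj_apply, Pi.single_eq_of_ne h, smul_eq_mul, mul_zero, if_neg h]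
  · intro x hx
    refine ⟨fun j => ?_, ?_⟩
    · have := hx j
      simp only [LinearMap.smul_apply, LinearMap.proj_apply, Pi.sub_apply, cv, smul_eq_mul]
      split_ifs <;> linarith [this.1, this.2]
    · ext k
      rw [Finset.sum_apply, sum_eq_single k]
      · simp only [LinearMap.smul_apply, LinearMap.proj_apply, Pi.sub_apply, cv, smul_eq_mul, Pi.smul_apply,
          Pi.single_eq_same]
        split_ifs <;> ring
      · intro j _ hj
        simp [Pi.single_eq_of_ne hj.symm]
      · simp

lemma hex_mem (σ : Equiv.Perm (Fin 3)) : permPoint 3 σ ∈ Perm2Hex := subset_convexHull ℝ _ ⟨σ, rfl⟩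

lemma hex_simple (σ : Equiv.Perm (Fin 3)) : SimpleAt Perm2Hex (permPoint 3 σ) (Fin 2) := by
  set p : Fin 3 → Fin 3 := fun k => σ.symm k with hp
  have p01 : p 0 ≠ p 1 := fun h => by simpa using σ.symm.injective h
  have p02 : p 0 ≠ p 2 := fun h => by simpa using σ.symm.injective h
  have p12 : p 1 ≠ p 2 := fun h => by simpa using σ.symm.injective h
  have hv : ∀ j, permPoint 3 σ (p j) = ![1,2,3] j := by
    intro j; rw [permPoint3, hp]; simp
  have ex : ∀ x y : Fin 3 → ℝ, (∀ j, x (p j) = y (p j)) → x = y := by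
    intro x y h; ext k
    have := h (σ k)
    simpa [hp] using this
  refine ⟨hex_mem σ, ![Pi.single (p 0) 1 - Pi.single (p 1) 1, Pi.single (p 1) 1 - Pi.single (p 2) 1],
    ![LinearMap.proj (p 0), - LinearMap.proj (p 2)], ?_, ?_, ?_⟩
  · intro j
    fin_cases j
    · have : permPoint 3 σ + (Pi.single (p 0) 1 - Pi.single (p 1) 1) = permPoint 3 (Equiv.swap 0 1 * σ) := by
        apply ex
        intro j
        have h2 : permPoint 3 (Equiv.swap 0 1 * σ) (p j) = ![1,2,3] (Equiv.swap 0 1 j) := by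
          rw [permPoint3]; simp [hp]
        rw [h2, Pi.add_apply, hv]
        fin_cases j
        · simp [p01]; norm_num
        · simp [p01.symm]; norm_num
        · simp [p02.symm, p12.symm, Equiv.swap_apply_of_ne_of_ne]
      change permPoint 3 σ + (Pi.single (p 0) 1 - Pi.single (p 1) 1) ∈ _
      rw [this]; exact hex_mem _
    · have : permPoint 3 σ + (Pi.single (p 1) 1 - Pi.single (p 2) 1) = permPoint 3 (Equiv.swap 1 2 * σ) := by
        apply ex
        intro j
        have h2 : permPoint 3 (Equiv.swap 1 2 * σ) (p j) = ![1,2,3] (Equiv.swap 1 2 j) := by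
          rw [permPoint3]; simp [hp]
        rw [h2, Pi.add_apply, hv]
        fin_cases j
        · simp [p01, p02, Equiv.swap_apply_of_ne_of_ne]
        · simp [p12]; norm_num
        · simp [p12.symm]; norm_num
      change permPoint 3 σ + (Pi.single (p 1) 1 - Pi.single (p 2) 1) ∈ _
      rw [this]; exact hex_mem _
  · intro i j
    fin_cases i <;> fin_cases j <;> simp [p01, p02, p02.symm, p12.symm]
  · intro x hx
    have hσ := hex_mem σ
    rw [hex_eq] at hx hσ
    have hsum : ∀ y : Fin 3 → ℝ, y (p 0) + y (p 1) + y (p 2) = y 0 + y 1 + y 2 := by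
      intro y
      have := Equiv.sum_comp σ.symm y
      simpa [Fin.sum_univ_three] using this
    refine ⟨?_, ?_⟩
    · intro j
      fin_cases j
      · have := (hx.1 (p 0)).1
        have h0 := hv 0
        simp at h0 ⊢; linarith
      · have := (hx.1 (p 2)).2
        have h0 := hv 2
        simp at h0 ⊢; linarith
    · apply ex
      have s1 := hsum x
      have s2 := hsum (permPoint 3 σ)
      have s3 := hx.2
      have s4 := hσ.2
      intro j
      fin_cases j
      · simp [p01, p02]
      · simp [p01.symm, p12]; linarith
      · simp [p02.symm, p12.symm]; ring

lemma permPoint_inj {n : ℕ} : Function.Injective (permPoint n) := by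
  intro u v h
  ext k
  have := congrFun h k
  unfold permPoint at this
  exact_mod_cast add_right_cancel this

/-- vertices of hexagon times cube -/
noncomputable def hcv (m : ℕ) (z : Equiv.Perm (Fin 3) × (Fin m → Bool)) : (Fin 3 → ℝ) × (Fin m → ℝ) :=
  (permPoint 3 z.1, cv z.2)

lemma hcv_inj (m : ℕ) : Function.Injective (hcv m) := by
  rintro ⟨a, b⟩ ⟨c, d⟩ h
  have h1 : permPoint 3 a = permPoint 3 c := congrArg Prod.fst h
  have h2 : cv b = cv d := congrArg Prod.snd h
  rw [permPoint_inj h1, cv_inj h2]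

lemma hc_hull (m : ℕ) : Perm2Hex ×ˢ cubeS m = convexHull ℝ (Set.range (hcv m)) := by
  have : Set.range (hcv m) = {x | ∃ σ : Equiv.Perm (Fin 3), x = permPoint 3 σ} ×ˢ Set.range (cv (m := m)) := by
    ext ⟨x, y⟩
    constructor
    · rintro ⟨⟨a, b⟩, h⟩
      exact ⟨⟨a, (congrArg Prod.fst h).symm⟩, ⟨b, congrArg Prod.snd h⟩⟩
    · rintro ⟨⟨a, ha⟩, ⟨b, hb⟩⟩
      exact ⟨(a, b), Prod.ext ha.symm hb⟩
  rw [this, convexHull_prod, ← cube_hull]; rfl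

lemma hc_simple (m : ℕ) (z : Equiv.Perm (Fin 3) × (Fin m → Bool)) :
    SimpleAt (Perm2Hex ×ˢ cubeS m) (hcv m z) (Fin 2 ⊕ Fin m) :=
  (hex_simple z.1).prod (cube_simple z.2)

end HexCube


section Final
open Equiv Finset
variable {n : ℕ}

/-- prefix sums -/
noncomputable def pf (i : ℕ) : (Fin n → ℝ) →ₗ[ℝ] ℝ :=
  ∑ k ∈ univ.filter (fun k : Fin n => k.val < i), LinearMap.proj k

lemma pf_apply (i : ℕ) (x : Fin n → ℝ) : pf i x = ∑ k ∈ univ.filter (fun k : Fin n => k.val < i), x k := by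
  unfold pf; simp

lemma pf_succ (k : Fin n) (x : Fin n → ℝ) : pf ((k:ℕ) + 1) x = pf k x + x k := by
  rw [pf_apply, pf_apply]
  have : univ.filter (fun j : Fin n => j.val < (k:ℕ) + 1) =
      insert k (univ.filter (fun j : Fin n => j.val < (k:ℕ))) := by
    ext j
    rw [mem_insert, mem_filter, mem_filter, Fin.ext_iff]
    simp only [mem_univ, true_and]
    omega
  rw [this, sum_insert (by simp)]; ring

lemma pf_pres {u : Perm (Fin n)} {i : ℕ} (h : Pres u i) : pf i (permPoint n u) = pf i (permPoint n 1) := by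
  rw [pf_apply, pf_apply]
  have himg : (univ.filter fun k : Fin n => k.val < i).image u = univ.filter fun k : Fin n => k.val < i := by
    apply eq_of_subset_of_card_le
    · intro x hx
      obtain ⟨k, hk, rfl⟩ := mem_image.1 hx
      rw [mem_filter] at hk ⊢
      exact ⟨mem_univ _, h k hk.2⟩
    · rw [card_image_of_injective _ u.injective]
  conv_rhs => rw [← himg]
  rw [sum_image (fun x _ y _ h => u.injective h)]
  rfl

lemma pf_mono (u : Perm (Fin n)) (i : ℕ) : pf i (permPoint n 1) ≤ pf i (permPoint n u) := by
  induction u using perm_ind with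
  | h1 => exact le_rfl
  | hs w A B h ha ih =>
    refine ih.trans ?_
    have hAB : A < B := by rw [Fin.lt_def]; omega
    by_cases hi : i = A + 1
    · subst hi
      rw [pf_succ, pf_succ]
      have : pf (A:ℕ) (permPoint n (w * swap A B)) = pf (A:ℕ) (permPoint n w) := by
        rw [pf_apply, pf_apply]
        apply sum_congr rfl
        intro k hk
        rw [mem_filter] at hk
        have hk2 : k < A := hk.2
        rw [permPoint_mul, Function.comp, swap_apply_of_ne_of_ne hk2.ne (hk2.trans hAB).ne]
      rw [this, permPoint_mul, Function.comp, swap_apply_left]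
      have : permPoint n w A ≤ permPoint n w B := by
        unfold permPoint
        have : (w A : ℕ) ≤ w B := ha.le
        have : ((w A : ℕ) : ℝ) ≤ (w B : ℕ) := by exact_mod_cast this
        linarith
      linarith
    · apply le_of_eq
      rw [pf_apply, pf_apply, permPoint_mul]
      refine sum_equiv (swap A B) ?_ ?_
      · intro k
        rw [mem_filter, mem_filter]
        simp only [mem_univ, true_and]
        rcases eq_or_ne k A with rfl | h1
        · rw [swap_apply_left]; omega
        rcases eq_or_ne k B with rfl | h2
        · rw [swap_apply_right]; omega
        rw [swap_apply_of_ne_of_ne h1 h2]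
      · intro k _
        simp [Function.comp]

/-- edge directions at the identity -/
noncomputable def dd (i : ℕ) : Fin n → ℝ := fun k => (if (k:ℕ) + 1 = i then 1 else 0) - (if (k:ℕ) = i then 1 else 0)

lemma dd_swap {A B : Fin n} (h : (B:ℕ) = A + 1) : permPoint n 1 + dd (B:ℕ) = permPoint n (swap A B) := by
  ext k
  simp only [Pi.add_apply, permPoint, dd, Perm.one_apply]
  rcases eq_or_ne k A with rfl | h1
  · rw [swap_apply_left, h]; simp
  rcases eq_or_ne k B with rfl | h2
  · rw [swap_apply_right, h]; simp
  rw [swap_apply_of_ne_of_ne h1 h2]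
  rw [Ne, Fin.ext_iff] at h1 h2
  rw [if_neg (by omega), if_neg (by omega)]; ring

lemma pf_dd {A B : Fin n} (h : (B:ℕ) = A + 1) (i : ℕ) : pf i (dd (n := n) (B:ℕ)) = if i = (B:ℕ) then 1 else 0 := by
  rw [pf_apply]
  unfold dd
  have e1 : ∀ k : Fin n, (k:ℕ) + 1 = B ↔ k = A := by intro k; rw [Fin.ext_iff]; omega
  simp only [e1, ← Fin.ext_iff, sum_sub_distrib, sum_ite_eq']
  simp only [mem_filter, mem_univ, true_and]
  split_ifs <;> first | omega | norm_num

lemma BD_simple (w : Perm (Fin n)) {A B : Fin n} (h : (B:ℕ) = A + 1) (hJ : (B:ℕ) ∈ Jset w) : BD (swap A B) w := by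
  induction w using perm_ind with
  | h1 => simp [Jset_one] at hJ
  | hs w A' B' h' ha ih =>
    rw [Jset_mul w h' ha, mem_insert] at hJ
    rcases hJ with hJ | hJ
    · have h1 : B = B' := Fin.ext hJ
      have h2 : A = A' := Fin.ext (by omega)
      subst h1 h2
      rw [BD_mul_iff h ha]
      right
      rw [swap_mul_self]
      exact (bruhat_iff _ _).1 (one_bruhat w)
    · exact BD_trans (ih hJ) (BD_self_mul w h' ha)

lemma bip_mem {u w : Perm (Fin n)} (h : BD u w) : permPoint n u ∈ BIP n 1 w := by
  rw [BIP_eq]; exact subset_convexHull ℝ _ ⟨u, h, rfl⟩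

lemma Jset_pos {w : Perm (Fin n)} {i : ℕ} (h : i ∈ Jset w) : ∃ A B : Fin n, (B:ℕ) = A + 1 ∧ (B:ℕ) = i := by
  rw [mem_Jset] at h
  have : i ≠ 0 := by
    rintro rfl
    exact h.2 (fun p hp => by omega)
  exact ⟨⟨i - 1, by omega⟩, ⟨i, h.1⟩, by simp; omega, rfl⟩

lemma bip_simple (w : Perm (Fin n)) : SimpleAt (BIP n 1 w) (permPoint n 1) {i // i ∈ Jset w} := by
  have hQ : ∀ (i : ℕ), ∀ x ∈ BIP n 1 w, 0 ≤ pf i (x - permPoint n 1) ∧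
      (i ≤ n → i ∉ Jset w → pf i (x - permPoint n 1) = 0) := by
    intro i x hx
    refine bip_ind w {x | 0 ≤ pf i (x - permPoint n 1) ∧
      (i ≤ n → i ∉ Jset w → pf i (x - permPoint n 1) = 0)} ?_ ?_ hx
    · rintro x ⟨hx1, hx2⟩ y ⟨hy1, hy2⟩ a b ha hb hab
      have key : pf i (a • x + b • y - permPoint n 1) =
          a * pf i (x - permPoint n 1) + b * pf i (y - permPoint n 1) := by
        simp only [map_sub, map_add, map_smul, smul_eq_mul]
        linear_combination (pf i (permPoint n 1)) * hab
      refine ⟨?_, fun h1 h2 => ?_⟩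
      · rw [key]; positivity
      · rw [key, hx2 h1 h2, hy2 h1 h2]; ring
    · intro u hu
      refine ⟨?_, fun h1 h2 => ?_⟩
      · rw [map_sub]; linarith [pf_mono u i]
      · have hP : Pres u i := by
          rcases h1.eq_or_lt with h3 | h3
          · subst h3; exact fun p _ => (u p).2
          · apply BD_Pres hu h1
            by_contra hh
            exact h2 ((mem_Jset w i).2 ⟨h3, hh⟩)
        rw [map_sub, pf_pres hP, sub_self]
  refine ⟨bip_mem ((bruhat_iff _ _).1 (one_bruhat w)), fun i => dd i.1, fun i => pf i.1, ?_, ?_, ?_⟩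
  · rintro ⟨i, hi⟩
    obtain ⟨A, B, h, rfl⟩ := Jset_pos hi
    rw [dd_swap h]
    exact bip_mem (BD_simple w h hi)
  · rintro ⟨i, hi⟩ ⟨j, hj⟩
    obtain ⟨A, B, h, rfl⟩ := Jset_pos hj
    rw [pf_dd h]
    simp
  · intro x hx
    refine ⟨fun j => (hQ j.1 x hx).1, ?_⟩
    rw [sum_coe_sort (Jset w) (fun i => pf i (x - permPoint n 1) • dd (n := n) i)]
    have hsub : Jset w ⊆ range (n+1) := by
      intro i hi
      rw [mem_Jset] at hi
      rw [mem_range]; omega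
    rw [sum_subset hsub]
    · ext k
      rw [Finset.sum_apply]
      simp only [Pi.smul_apply, smul_eq_mul, dd, mul_sub, mul_ite, mul_one, mul_zero, sum_sub_distrib, sum_ite_eq]
      rw [if_pos (by rw [mem_range]; omega), if_pos (by rw [mem_range]; omega), pf_succ]
      ring
    · intro i hi hiJ
      rw [mem_range] at hi
      rw [(hQ i x hx).2 (by omega) hiJ, zero_smul]

/-- vertices of the Bruhat interval polytope -/
noncomputable def bv (w : Perm (Fin n)) (u : {u // u ∈ LI w}) : Fin n → ℝ := permPoint n u.1

lemma bv_inj (w : Perm (Fin n)) : Function.Injective (bv w) :=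
  fun _ _ h => Subtype.ext (permPoint_inj h)

lemma bip_hull (w : Perm (Fin n)) : BIP n 1 w = convexHull ℝ (Set.range (bv w)) := by
  rw [BIP_eq]
  congr 1
  ext x
  constructor
  · rintro ⟨u, hu, rfl⟩; exact ⟨⟨u, mem_LI.2 hu⟩, rfl⟩
  · rintro ⟨⟨u, hu⟩, rfl⟩; exact ⟨u, mem_LI.1 hu, rfl⟩

lemma bv_face (w : Perm (Fin n)) (u) : IsFaceOf (convexHull ℝ (Set.range (bv w))) {bv w u} := by
  apply exposed_face _ _ (∑ k, (permPoint n u.1 k) • LinearMap.proj k)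
  intro v hv
  simp only [LinearMap.sum_apply, LinearMap.smul_apply, LinearMap.proj_apply, smul_eq_mul, bv]
  have hsq : ∀ t : Perm (Fin n), ∑ k, permPoint n t k * permPoint n t k = ∑ k, permPoint n 1 k * permPoint n 1 k :=
    fun t => Equiv.sum_comp t (fun k => permPoint n 1 k * permPoint n 1 k)
  have h1 := hsq u.1
  have h2 := hsq v.1
  have hne : permPoint n u.1 ≠ permPoint n v.1 := fun h => hv (Subtype.ext (permPoint_inj h).symm)
  obtain ⟨k0, hk0⟩ := Function.ne_iff.1 hne
  have hpos : 0 < ∑ k, (permPoint n u.1 k - permPoint n v.1 k)^2 := by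
    apply sum_pos' (fun k _ => sq_nonneg _)
    exact ⟨k0, mem_univ _, by have := sub_ne_zero.2 hk0; positivity⟩
  have hexp : ∑ k, (permPoint n u.1 k - permPoint n v.1 k)^2 =
      ∑ k, permPoint n u.1 k * permPoint n u.1 k + ∑ k, permPoint n v.1 k * permPoint n v.1 k
       - 2 * ∑ k, permPoint n u.1 k * permPoint n v.1 k := by
    rw [mul_sum, ← sum_add_distrib, ← sum_sub_distrib]
    apply sum_congr rfl
    intro k _
    ring
  linarith

theorem forward_count (w : Perm (Fin n)) (m : ℕ) (h : CombEquiv (BIP n 1 w) (Perm2Hex ×ˢ cubeS m)) :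
    (LI w).card = 6 * 2 ^ m ∧ (Jset w).card = m + 2 := by
  have hb := bip_simple w
  have hc := hc_simple m
  rw [hc_hull] at hc
  rw [bip_hull] at hb
  rw [bip_hull, hc_hull] at h
  obtain ⟨h1, h2⟩ := transport (bv w) (hcv m) (bv_inj w) (hcv_inj m) (bv_face w)
    (fun z => simple_singleton (convex_convexHull ℝ _) (hc z)) h
  refine ⟨?_, ?_⟩
  · rw [Fintype.card_coe] at h1
    rw [h1, Fintype.card_prod, Fintype.card_perm]
    simp [Nat.factorial]
  · obtain ⟨z, hz⟩ := h2 ⟨1, mem_LI.2 ((bruhat_iff _ _).1 (one_bruhat w))⟩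
    have e1 := simple_count (convex_convexHull ℝ _) hb
    have e2 := simple_count (convex_convexHull ℝ _) (hc z)
    change Nat.card _ = _ at e1
    rw [e2] at hz
    have e3 := e1.symm.trans hz
    have := Nat.pow_right_injective (le_refl 2) e3
    simp at this
    omega

theorem main17 (w : Perm (Fin n)) :
    CombEquiv (BIP n 1 w) (Perm2Hex ×ˢ cubeS (permLen n w - 3)) ↔ C1 w := by
  rw [permLen_eq]
  constructor
  · intro h
    obtain ⟨h1, h2⟩ := forward_count w _ h
    by_cases h3 : invN w < 3
    · have h0 : invN w - 3 = 0 := by omega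
      have h4 := card_Jset_le w
      have h5 : (Jset w).card = invN w := by omega
      have h6 := (Z0 w h5).2.2
      have h7 : invN w = 2 := by omega
      rw [h6, h0, h7] at h1
      norm_num at h1
    · apply C1_of_count w (by omega)
      rw [h1]
      obtain ⟨k, hk⟩ : ∃ k, invN w = k + 3 := ⟨invN w - 3, by omega⟩
      rw [hk, Nat.add_sub_cancel, pow_add]; ring
  · intro h
    exact (C1_hex _ w rfl h).2

end Final

/-- `Q_{e,w}` is combinatorially equivalent to the product of the
hexagon `Perm₂` and the cube `I^{ℓ(w) - 3}` iff `w` contains 321 exactly once and avoids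
3412. -/
theorem stmt17 (n : ℕ) (w : Equiv.Perm (Fin n)) :
    CombEquiv (BIP n 1 w)
        (Perm2Hex ×ˢ {x : Fin (permLen n w - 3) → ℝ | ∀ k, x k ∈ Set.Icc (0 : ℝ) 1}) ↔
      ContainsPatternOnce w pattern321 ∧ AvoidsPattern w pattern3412 := by
  rw [pattern_iff]
  exact main17 w
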